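/- arXiv:1702.06448 — 3 statements merged into one kernel-verified Lean document; each statement's English description precedes it below -/
import Mathlib

section
/- Let F be a field which is finitely generated over its prime field, and let E be a proper subfield of F such that E is isomorphic to F as a field. Then E is not existentially closed in F: there is a finite system of polynomial equations and inequations with coefficients in E which has a solution in F but no solution in E. In particular, no finitely generated field contains a proper existentially closed subfield isomorphic to itself. -/
/-- A field generated as a field by a finite set has finite transcendence degree over any
subfield. -/
theorem Subfield.trdeg_lt_aleph0_of_closure_eq_top {F : Type*} [Field F] (k : Subfield F)
    {s : Finset F} (hs : Subfield.closure (s : Set F) = ⊤) :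
    Algebra.trdeg k F < Cardinal.aleph0 := by
  have : Algebra.IsAlgebraic (Algebra.adjoin k (s : Set F)) F := by
    refine ⟨fun x ↦ ?_⟩
    have hx : x ∈ Subfield.closure (s : Set F) := hs ▸ Subfield.mem_top x
    have hle : Subring.closure (s : Set F) ≤ (Algebra.adjoin k (s : Set F)).toSubring :=
      Subring.closure_le.2 Algebra.subset_adjoin
    obtain ⟨y, hy, z, hz, rfl⟩ := Subfield.mem_closure_iff.1 hx
    rw [div_eq_mul_inv]
    exact (isAlgebraic_algebraMap (⟨y, hle hy⟩ : Algebra.adjoin k (s : Set F))).mul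
      (isAlgebraic_algebraMap (⟨z, hle hz⟩ : Algebra.adjoin k (s : Set F))).inv
  exact (Algebra.IsAlgebraic.trdeg_le_cardinalMk k (s : Set F)).trans_lt
    (Cardinal.lt_aleph0_of_finite _)

/-- A field of finite transcendence degree over its prime field is algebraic over each subfield
isomorphic to it. -/
theorem Subfield.isAlgebraic_of_ringEquiv {F : Type*} [Field F]
    (hF : Algebra.trdeg (⊥ : Subfield F) F < Cardinal.aleph0) (E : Subfield F) (e : E ≃+* F) :
    Algebra.IsAlgebraic E F := by
  let := (Subfield.inclusion (bot_le : ⊥ ≤ E)).toAlgebra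
  have : IsScalarTower (⊥ : Subfield F) E F := IsScalarTower.of_algebraMap_eq fun _ ↦ rfl
  have hfix (x : (⊥ : Subfield F)) : (e.symm x : F) = x :=
    (bot_le : ⊥ ≤ (E.subtype.comp (e.symm : F →+* E)).eqLocusField (RingHom.id F)) x.2
  let f : F ≃ₐ[(⊥ : Subfield F)] E :=
    AlgEquiv.ofRingEquiv (f := e.symm) fun x ↦ Subtype.ext (hfix x)
  have hadd := trdeg_add_eq (⊥ : Subfield F) E (A := F)
  rw [← f.trdeg_eq] at hadd
  rw [← trdeg_eq_zero_iff]
  exact Cardinal.eq_of_add_eq_add_left (hadd.trans (add_zero _).symm) hF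

/-- A field `F` which is finitely generated over its prime field and contains a proper subfield
`E` isomorphic to `F` admits a finite system of polynomial equations and inequations with
coefficients in `E` which is solvable in `F` but not in `E`; i.e. `E` is not existentially
closed in `F`. -/
theorem stmt0 {F : Type*} [Field F]
    (hfg : ∃ s : Finset F, Subfield.closure (s : Set F) = ⊤)
    (E : Subfield F) (hproper : E ≠ ⊤) (hiso : Nonempty (E ≃+* F)) :
    ∃ (n : ℕ) (P N : Finset (MvPolynomial (Fin n) E)),
      (∃ x : Fin n → F,
        (∀ p ∈ P, MvPolynomial.eval₂ E.subtype x p = 0) ∧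
        (∀ p ∈ N, MvPolynomial.eval₂ E.subtype x p ≠ 0)) ∧
      ¬ ∃ y : Fin n → E,
        (∀ p ∈ P, MvPolynomial.eval y p = 0) ∧
        (∀ p ∈ N, MvPolynomial.eval y p ≠ 0) := by
  obtain ⟨s, hs⟩ := hfg
  obtain ⟨e⟩ := hiso
  have halg := E.isAlgebraic_of_ringEquiv (Subfield.trdeg_lt_aleph0_of_closure_eq_top ⊥ hs) e
  obtain ⟨a, -, ha⟩ := SetLike.exists_of_lt hproper.lt_top
  have hint : IsIntegral E a := (halg.isAlgebraic a).isIntegral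
  refine ⟨1, {(minpoly E a).toMvPolynomial 0}, ∅, ⟨fun _ ↦ a, ?_, by simp⟩, ?_⟩
  · simp only [Finset.mem_singleton, forall_eq]
    change MvPolynomial.aeval (fun _ ↦ a) _ = 0
    simp
  · rintro ⟨y, hy, -⟩
    have hroot : (minpoly E a).IsRoot (y 0) := by
      simpa [MvPolynomial.eval_toMvPolynomial] using hy _ (Finset.mem_singleton_self _)
    have hdeg := Polynomial.degree_eq_one_of_irreducible_of_root (minpoly.irreducible hint) hroot
    obtain ⟨b, rfl⟩ := minpoly.mem_range_of_degree_eq_one E a hdeg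
    exact ha b.2
end

section
/- G is self-reflective: G is finitely generated and contains a proper subgroup, namely H, which is isomorphic to G and existentially closed in G. -/
/-- Generators of the group `K`: tree vertices `(n,τ)`, the letter `a`, and letters `bᵢ`. -/
inductive KGen : Type
  | vert : ℕ → List ℤ → KGen
  | a : KGen
  | b : ℤ → KGen
  deriving DecidableEq

/-- The parent `(n,τ)⁻` of a vertex `(n,τ)` of the tree `T`. -/
def parent : ℕ → List ℤ → ℕ × List ℤ
  | n, [] => (n + 1, [])
  | n, τ => (n, τ.dropLast)

/-- Words over an alphabet `α` (a letter together with `true` for the letter itself,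
`false` for its formal inverse). -/
abbrev Word (α : Type) := List (α × Bool)

/-- The word `u(x,y) = x y x² y x³ y ⋯ x¹⁰⁰ y`. -/
def uWord {α : Type} (x y : α) : Word α :=
  (List.range 100).flatMap fun k => List.replicate (k + 1) (x, true) ++ [(y, true)]

/-- The relator words of the presentation of `K`:
`u((n,τ),a) ((n,τ)⁻)⁻¹` and `u((n,τ),bᵢ) ((n,τ⌢⟨i⟩))⁻¹`. -/
def KRelWords : Set (Word KGen) :=
  { w | (∃ (n : ℕ) (τ : List ℤ), w = uWord (KGen.vert n τ) KGen.a ++ [(KGen.vert (parent n τ).1 (parent n τ).2, false)]) ∨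
        (∃ (n : ℕ) (τ : List ℤ) (i : ℤ), w = uWord (KGen.vert n τ) (KGen.b i) ++ [(KGen.vert n (τ ++ [i]), false)]) }

/-- The relators of `K` as elements of the free group. -/
def KRels : Set (FreeGroup KGen) := FreeGroup.mk '' KRelWords

/-- The group `K`. -/
abbrev K := PresentedGroup KRels

/-- Generators of `G`: the generators of `K` together with the stable letter `t = none`. -/
abbrev GGen := Option KGen

/-- The relator words of the presentation of `G = ⟨K, t ∣ t bᵢ t⁻¹ = b_{i+1}⟩`:
the relators of `K` together with `t bᵢ t⁻¹ b_{i+1}⁻¹`. -/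
def GRelWords : Set (Word GGen) :=
  (fun w : Word KGen => w.map fun p => (some p.1, p.2)) '' KRelWords ∪
    { w | ∃ i : ℤ, w = [((none : GGen), true), (some (KGen.b i), true), ((none : GGen), false),
        (some (KGen.b (i + 1)), false)] }

/-- The relators of `G` as elements of the free group. -/
def GRels : Set (FreeGroup GGen) := FreeGroup.mk '' GRelWords

/-- The group `G`, the HNN extension of `K` along `bᵢ ↦ b_{i+1}`. -/
abbrev G := PresentedGroup GRels

/-- The vertex `(n,τ)` as an element of `G`. -/
def gvert (n : ℕ) (τ : List ℤ) : G := PresentedGroup.of (some (KGen.vert n τ))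

/-- `a` as an element of `G`. -/
def ga : G := PresentedGroup.of (some KGen.a)

/-- `bᵢ` as an element of `G`. -/
def gb (i : ℤ) : G := PresentedGroup.of (some (KGen.b i))

/-- The stable letter `t` as an element of `G`. -/
def gt' : G := PresentedGroup.of (none : GGen)

/-- The subgroup `H` of `G` generated by `(1,⟨⟩)`, `a`, `b₀` and `t`. -/
def H : Subgroup G := Subgroup.closure {gvert 1 [], ga, gb 0, gt'}

/-- A subgroup `H` of a group `Γ` is existentially closed in `Γ` if every finite system of
equations and inequations (given by words in the free group on `k + m` generators, the first `k`
of which are substituted by a fixed tuple from `H`) having a solution in `Γ` already has a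
solution in `H`. -/
def ExistentiallyClosedSubgroup {Γ : Type*} [Group Γ] (H : Subgroup Γ) : Prop :=
  ∀ (k m : ℕ) (h : Fin k → H) (P N : Finset (FreeGroup (Fin k ⊕ Fin m))),
    (∃ g : Fin m → Γ,
      (∀ w ∈ P, FreeGroup.lift (Sum.elim (fun i => (h i : Γ)) g) w = 1) ∧
      (∀ w ∈ N, FreeGroup.lift (Sum.elim (fun i => (h i : Γ)) g) w ≠ 1)) →
    ∃ g' : Fin m → H,
      (∀ w ∈ P, FreeGroup.lift (Sum.elim (fun i => (h i : Γ)) (fun j => (g' j : Γ))) w = 1) ∧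
      (∀ w ∈ N, FreeGroup.lift (Sum.elim (fun i => (h i : Γ)) (fun j => (g' j : Γ))) w ≠ 1)

/-- The word `x y² x³ y⁴ ⋯ x⁹⁹ y¹⁰⁰`, evaluated in a group. -/
def altVal {M : Type*} [Group M] (x y : M) : M :=
  ((List.range 50).map fun k => x ^ (2 * k + 1) * y ^ (2 * k + 2)).prod

theorem map_altVal {M N : Type*} [Group M] [Group N] (f : M →* N) (x y : M) :
    f (altVal x y) = altVal (f x) (f y) := by
  simp [altVal, map_list_prod, Function.comp_def]

section PingPong

open scoped Pointwise

variable {B : Type*} [DecidableEq B]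

/-- The elements of a free group whose reduced word starts with the letter `(b, e)`. -/
def headSet (b : B) (e : Bool) : Set (FreeGroup B) := {z | z.toWord.head? = some (b, e)}

/-- The elements of a free group whose reduced word starts with a power of `b`. -/
def headGen (b : B) : Set (FreeGroup B) := {z | ∃ e, z ∈ headSet b e}

theorem mk_mul_mem_headSet {b : B} {e : Bool} {z : FreeGroup B} (hz : z ∉ headSet b (!e)) :
    FreeGroup.mk [(b, e)] * z ∈ headSet b e := by
  have h1 : (FreeGroup.mk [(b, e)] * z).toWord = FreeGroup.reduce ((b, e) :: z.toWord) := by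
    conv_lhs => rw [← FreeGroup.mk_toWord (x := z), FreeGroup.mul_mk]
    simp [FreeGroup.toWord_mk]
  have h2 : FreeGroup.reduce z.toWord = z.toWord := FreeGroup.reduce_toWord z
  simp only [headSet, Set.mem_ofPred_eq] at hz ⊢
  rw [h1, FreeGroup.reduce.cons, h2]
  rcases hw : z.toWord with _ | ⟨⟨c, f⟩, L⟩
  · rfl
  · rw [hw] at hz
    simp only [List.head?_cons, Option.some.injEq, Prod.mk.injEq] at hz
    dsimp only
    rw [if_neg]
    · rfl
    · rintro ⟨h, h'⟩
      apply hz
      subst h h'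
      simp

theorem pow_mk_mul_mem_headSet {b : B} {e : Bool} {z : FreeGroup B} (hz : z ∉ headSet b (!e))
    (n : ℕ) : FreeGroup.mk [(b, e)] ^ (n + 1) * z ∈ headSet b e := by
  induction n with
  | zero => simpa using mk_mul_mem_headSet hz
  | succ n ih =>
    rw [pow_succ', mul_assoc]
    apply mk_mul_mem_headSet
    intro h
    simp [headSet] at ih h
    simp [ih] at h

theorem zpow_mul_mem_headGen {b : B} {z : FreeGroup B} (hz : z ∉ headGen b) {k : ℤ} (hk : k ≠ 0) :
    FreeGroup.of b ^ k * z ∈ headGen b := by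
  have hz' : ∀ e, z ∉ headSet b e := fun e he => hz ⟨e, he⟩
  rcases k with (_ | n) | n
  · simp at hk
  · refine ⟨true, ?_⟩
    have := pow_mk_mul_mem_headSet (hz' (!true)) n
    exact_mod_cast this
  · refine ⟨false, ?_⟩
    have := pow_mk_mul_mem_headSet (hz' (!false)) n
    rw [zpow_negSucc, ← inv_pow]
    exact this

theorem notMem_headGen_of_mem {b c : B} (h : b ≠ c) {z : FreeGroup B} (hz : z ∈ headGen b) :
    z ∉ headGen c := by
  rintro ⟨e, he⟩
  obtain ⟨f, hf⟩ := hz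
  simp only [headSet, Set.mem_ofPred_eq] at he hf
  rw [he] at hf
  simp only [Option.some.injEq, Prod.mk.injEq] at hf
  exact h hf.1.symm

/-- Elements which, together with their inverse, send the complement of `headGen x` into
`headGen x`. -/
def Swallows (x : B) (g : FreeGroup B) : Prop :=
  (∀ z ∉ headGen x, g * z ∈ headGen x) ∧ ∀ z ∉ headGen x, g⁻¹ * z ∈ headGen x

theorem swallows_zpow (x : B) {k : ℤ} (hk : k ≠ 0) : Swallows x (FreeGroup.of x ^ k) :=
  ⟨fun _ hz => zpow_mul_mem_headGen hz hk, fun z hz => by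
    rw [← zpow_neg]; exact zpow_mul_mem_headGen hz (neg_ne_zero.mpr hk)⟩

theorem Swallows.mul_zpow_mul_zpow {x y : B} (hxy : x ≠ y) {g : FreeGroup B} (hg : Swallows x g)
    {k l : ℤ} (hk : k ≠ 0) (hl : l ≠ 0) :
    Swallows x (g * (FreeGroup.of y ^ k * FreeGroup.of x ^ l)) := by
  constructor
  · intro z hz
    rw [mul_assoc, mul_assoc]
    apply hg.1
    apply notMem_headGen_of_mem hxy.symm
    apply zpow_mul_mem_headGen _ hk
    apply notMem_headGen_of_mem hxy
    exact zpow_mul_mem_headGen hz hl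
  · intro z hz
    rw [mul_inv_rev, mul_inv_rev, mul_assoc, mul_assoc, ← zpow_neg, ← zpow_neg]
    apply zpow_mul_mem_headGen _ (neg_ne_zero.mpr hl)
    apply notMem_headGen_of_mem hxy.symm
    apply zpow_mul_mem_headGen _ (neg_ne_zero.mpr hk)
    apply notMem_headGen_of_mem hxy
    exact hg.2 z hz

theorem Swallows.mul_prod {x y : B} (hxy : x ≠ y) {g : FreeGroup B} (hg : Swallows x g)
    (k l : ℕ → ℕ) (hk : ∀ i, k i ≠ 0) (hl : ∀ i, l i ≠ 0) (n : ℕ) :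
    Swallows x (g * ((List.range n).map fun i =>
      FreeGroup.of y ^ k i * FreeGroup.of x ^ l i).prod) := by
  induction n with
  | zero => simpa using hg
  | succ n ih =>
    rw [List.range_succ, List.map_append, List.prod_append, ← mul_assoc]
    simpa using ih.mul_zpow_mul_zpow hxy (k := k n) (l := l n) (by exact_mod_cast hk n)
      (by exact_mod_cast hl n)

/-- The set of elements `y ^ i * z` with the reduced word of `z` starting with a power of `x`. -/
def shiftSet (x y : B) (i : ℤ) : Set (FreeGroup B) :=
  {z | FreeGroup.of y ^ (-i) * z ∈ headGen x}

theorem shiftSet_subset {x y : B} (hxy : x ≠ y) {i : ℤ} (hi : i ≠ 0) :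
    shiftSet x y i ⊆ headGen y := by
  intro z hz
  have := zpow_mul_mem_headGen (notMem_headGen_of_mem hxy hz) hi
  rwa [← mul_assoc, ← zpow_add, add_neg_cancel, zpow_zero, one_mul] at this

theorem disjoint_shiftSet {x y : B} (hxy : x ≠ y) {i j : ℤ} (hij : i ≠ j) :
    Disjoint (shiftSet x y i) (shiftSet x y j) := by
  rw [Set.disjoint_left]
  intro z hz hz'
  have := zpow_mul_mem_headGen (notMem_headGen_of_mem hxy hz) (sub_ne_zero.mpr hij)
  rw [← mul_assoc, ← zpow_add, show i - j + -i = -j by ring] at this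
  exact notMem_headGen_of_mem hxy hz' this

theorem Swallows.zpow_mul_zpow {x y : B} {g : FreeGroup B} (hg : Swallows x g) (i j : ℤ) :
    (FreeGroup.of y ^ i * g * FreeGroup.of y ^ j) • (shiftSet x y (-j))ᶜ ⊆ shiftSet x y i ∧
    (FreeGroup.of y ^ i * g * FreeGroup.of y ^ j)⁻¹ • (shiftSet x y i)ᶜ ⊆ shiftSet x y (-j) := by
  constructor
  · rintro _ ⟨z, hz, rfl⟩
    simp only [shiftSet, neg_neg, Set.mem_compl_iff, Set.mem_ofPred_eq, smul_eq_mul] at hz ⊢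
    rw [mul_assoc, mul_assoc, ← mul_assoc, zpow_neg, inv_mul_cancel, one_mul]
    exact hg.1 _ hz
  · rintro _ ⟨z, hz, rfl⟩
    simp only [shiftSet, neg_neg, Set.mem_compl_iff, Set.mem_ofPred_eq, smul_eq_mul] at hz ⊢
    rw [mul_inv_rev, mul_inv_rev, ← mul_assoc, ← mul_assoc, mul_inv_cancel, one_mul, ← zpow_neg,
      mul_assoc]
    exact hg.2 _ hz

theorem of_smul_headSet (b : B) : FreeGroup.of b • (headSet b false)ᶜ ⊆ headSet b true ∧
    (FreeGroup.of b)⁻¹ • (headSet b true)ᶜ ⊆ headSet b false := by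
  constructor
  · rintro _ ⟨z, hz, rfl⟩
    exact mk_mul_mem_headSet (e := true) hz
  · rintro _ ⟨z, hz, rfl⟩
    exact mk_mul_mem_headSet (e := false) hz

theorem disjoint_headSet {b c : B} {e f : Bool} (h : (b, e) ≠ (c, f)) :
    Disjoint (headSet b e) (headSet c f) := by
  rw [Set.disjoint_left]
  intro z hz hz'
  simp only [headSet, Set.mem_ofPred_eq] at hz hz'
  rw [hz] at hz'
  exact h (Option.some.inj hz')

theorem disjoint_headSet_shiftSet {x y b : B} {e : Bool} (hxy : x ≠ y) (hb : b ≠ y) {i : ℤ}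
    (hi : i ≠ 0) : Disjoint (headSet b e) (shiftSet x y i) := by
  rw [Set.disjoint_left]
  intro z hz hz'
  exact notMem_headGen_of_mem hb ⟨e, hz⟩ (shiftSet_subset hxy hi hz')

theorem shiftSet_nonempty (x y : B) (i : ℤ) : (shiftSet x y i).Nonempty :=
  ⟨FreeGroup.of y ^ i * FreeGroup.of x, true, by
    simp [headSet, ← mul_assoc, FreeGroup.toWord_of]⟩

variable {U : Type*} [DecidableEq U]

/-- The letters `some u` together with two elements of the form `y² g y¹⁰⁰` and `y h y⁹⁹`. -/
def pingPongFamily (g h : FreeGroup (Option U)) : U ⊕ Bool → FreeGroup (Option U)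
  | .inl u => .of (some u)
  | .inr true => .of none ^ (2 : ℤ) * g * .of none ^ (100 : ℤ)
  | .inr false => .of none ^ (1 : ℤ) * h * .of none ^ (99 : ℤ)

theorem injective_lift_pingPongFamily (r : U) {g h : FreeGroup (Option U)}
    (hg : Swallows (some r) g) (hh : Swallows (some r) h) :
    Function.Injective (FreeGroup.lift (pingPongFamily g h)) := by
  have hry : (some r : Option U) ≠ none := by simp
  let X : U ⊕ Bool → Set (FreeGroup (Option U)) := fun
    | .inl u => headSet (some u) true
    | .inr true => shiftSet (some r) none 2
    | .inr false => shiftSet (some r) none 1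
  let Y : U ⊕ Bool → Set (FreeGroup (Option U)) := fun
    | .inl u => headSet (some u) false
    | .inr true => shiftSet (some r) none (-100)
    | .inr false => shiftSet (some r) none (-99)
  have : Nontrivial (U ⊕ Bool) := ⟨.inr true, .inr false, by simp⟩
  refine FreeGroup.injective_lift_of_ping_pong _ X Y ?_ ?_ ?_ ?_ ?_ ?_
  · rintro (u | _ | _)
    · exact ⟨.of (some u), by simp [X, headSet, FreeGroup.toWord_of]⟩
    · exact shiftSet_nonempty _ _ _
    · exact shiftSet_nonempty _ _ _
  · rintro (u | _ | _) (v | _ | _) huv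
    · exact disjoint_headSet (by simpa using huv)
    · exact disjoint_headSet_shiftSet hry (by simp) (by norm_num)
    · exact disjoint_headSet_shiftSet hry (by simp) (by norm_num)
    · exact (disjoint_headSet_shiftSet hry (by simp) (by norm_num)).symm
    · exact absurd rfl huv
    · exact disjoint_shiftSet hry (by norm_num)
    · exact (disjoint_headSet_shiftSet hry (by simp) (by norm_num)).symm
    · exact disjoint_shiftSet hry (by norm_num)
    · exact absurd rfl huv
  · rintro (u | _ | _) (v | _ | _) huv
    · exact disjoint_headSet (by simpa using huv)
    · exact disjoint_headSet_shiftSet hry (by simp) (by norm_num)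
    · exact disjoint_headSet_shiftSet hry (by simp) (by norm_num)
    · exact (disjoint_headSet_shiftSet hry (by simp) (by norm_num)).symm
    · exact absurd rfl huv
    · exact disjoint_shiftSet hry (by norm_num)
    · exact (disjoint_headSet_shiftSet hry (by simp) (by norm_num)).symm
    · exact disjoint_shiftSet hry (by norm_num)
    · exact absurd rfl huv
  · rintro (u | _ | _) (v | _ | _)
    · exact disjoint_headSet (by simp)
    · exact disjoint_headSet_shiftSet hry (by simp) (by norm_num)
    · exact disjoint_headSet_shiftSet hry (by simp) (by norm_num)
    · exact (disjoint_headSet_shiftSet hry (by simp) (by norm_num)).symm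
    · exact disjoint_shiftSet hry (by norm_num)
    · exact disjoint_shiftSet hry (by norm_num)
    · exact (disjoint_headSet_shiftSet hry (by simp) (by norm_num)).symm
    · exact disjoint_shiftSet hry (by norm_num)
    · exact disjoint_shiftSet hry (by norm_num)
  · rintro (u | _ | _)
    · exact (of_smul_headSet _).1
    · exact (hh.zpow_mul_zpow 1 99).1
    · exact (hg.zpow_mul_zpow 2 100).1
  · rintro (u | _ | _)
    · exact (of_smul_headSet _).2
    · exact (hh.zpow_mul_zpow 1 99).2
    · exact (hg.zpow_mul_zpow 2 100).2

theorem prod_alt_eq {M : Type*} [Group M] (x y : M) (n : ℕ) :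
    ((List.range (n + 2)).map fun k => x ^ (2 * k + 1) * y ^ (2 * k + 2)).prod =
      x * (y ^ 2 * (x ^ 3 * ((List.range n).map fun k => y ^ (2 * k + 4) * x ^ (2 * k + 5)).prod) *
        y ^ (2 * n + 4)) := by
  induction n with
  | zero => simp [List.range_succ, mul_assoc]
  | succ n ih =>
    rw [List.range_succ, List.map_append, List.prod_append, ih, List.range_succ, List.map_append,
      List.prod_append]
    simp only [List.map_singleton, List.prod_singleton, mul_assoc]
    ring_nf

theorem prod_alt_eq' {M : Type*} [Group M] (x y : M) (n : ℕ) :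
    ((List.range (n + 2)).map fun k => y ^ (2 * k + 1) * x ^ (2 * k + 2)).prod =
      y * (x ^ 2 * ((List.range n).map fun k => y ^ (2 * k + 3) * x ^ (2 * k + 4)).prod) *
        y ^ (2 * n + 3) * x ^ (2 * n + 4) := by
  induction n with
  | zero => simp [List.range_succ, mul_assoc]
  | succ n ih =>
    rw [List.range_succ, List.map_append, List.prod_append, ih, List.range_succ, List.map_append,
      List.prod_append]
    simp only [List.map_singleton, List.prod_singleton, mul_assoc]
    ring_nf

/-- The letters `some u` together with the two alternating words in `some r` and `none`. -/
def altFamily (r : U) : U ⊕ Bool → FreeGroup (Option U)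
  | .inl u => .of (some u)
  | .inr true => altVal (.of (some r)) (.of none)
  | .inr false => altVal (.of none) (.of (some r))

end PingPong

theorem injective_lift_altFamily {U : Type*} (r : U) :
    Function.Injective (FreeGroup.lift (altFamily r)) := by
  classical
  set x : FreeGroup (Option U) := .of (some r) with hx
  set y : FreeGroup (Option U) := .of none with hy
  have hry : (some r : Option U) ≠ none := by simp
  have hg := (swallows_zpow (some r : Option U) (k := 3) (by norm_num)).mul_prod hry
    (fun k => 2 * k + 4) (fun k => 2 * k + 5) (by simp) (by simp) 48
  have hh := (swallows_zpow (some r : Option U) (k := 2) (by norm_num)).mul_prod hry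
    (fun k => 2 * k + 3) (fun k => 2 * k + 4) (by simp) (by simp) 48
  have key := injective_lift_pingPongFamily r hg hh
  let f : U ⊕ Bool → FreeGroup (U ⊕ Bool) := fun
    | .inl u => .of (.inl u)
    | .inr true => .of (.inl r) * .of (.inr true)
    | .inr false => .of (.inr false) * .of (.inl r) ^ 100
  let f' : U ⊕ Bool → FreeGroup (U ⊕ Bool) := fun
    | .inl u => .of (.inl u)
    | .inr true => (.of (.inl r))⁻¹ * .of (.inr true)
    | .inr false => .of (.inr false) * (.of (.inl r) ^ 100)⁻¹
  have hf : Function.LeftInverse (FreeGroup.lift f') (FreeGroup.lift f) := by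
    intro w
    have : (FreeGroup.lift f').comp (FreeGroup.lift f) = MonoidHom.id _ := by
      ext (u | _ | _) <;> simp [f, f']
    exact DFunLike.congr_fun this w
  have hfin := key.comp hf.injective
  rw [← MonoidHom.coe_comp] at hfin
  refine (congrArg (fun h : _ →* _ => Function.Injective h) ?_).mpr hfin
  · ext (u | _ | _)
    · simp [altFamily, pingPongFamily, f]
    · have := prod_alt_eq' x y 48
      simp only [altFamily, f, altVal, MonoidHom.comp_apply, FreeGroup.lift_apply_of, map_mul,
        pingPongFamily]
      rw [this]
      norm_num [hx, hy, pingPongFamily]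
    · have := prod_alt_eq x y 48
      simp only [altFamily, f, altVal, MonoidHom.comp_apply, FreeGroup.lift_apply_of, map_mul,
        pingPongFamily]
      rw [this]
      norm_num [hx, hy]

namespace Monoid.PushoutI

theorem NormalWord.exists_prod_eq {ι : Type*} {G : ι → Type*} {H : Type*} [∀ i, Group (G i)]
    [Group H] {φ : ∀ i, H →* G i} (d : NormalWord.Transversal φ) (x : PushoutI φ) :
    ∃ w : NormalWord d, w.prod = x := by
  classical
  exact ⟨NormalWord.equiv x, NormalWord.equiv.symm_apply_apply x⟩

theorem NormalWord.reduced {ι : Type*} {G : ι → Type*} {H : Type*} [∀ i, Group (G i)]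
    [Group H] {φ : ∀ i, H →* G i} {d : NormalWord.Transversal φ} (w : NormalWord d) :
    Reduced φ w.toWord := by
  rintro ⟨i, g⟩ hg hr
  have hne := w.ne_one _ hg
  have hs := w.normalized i g hg
  have := (d.compl i).1 (a₁ := (⟨g, hr⟩, ⟨1, d.one_mem i⟩)) (a₂ := (⟨1, one_mem _⟩, ⟨g, hs⟩))
    (by simp)
  simp only [Prod.mk.injEq, Subtype.mk.injEq] at this
  exact hne this.1

/-- A morphism of amalgamated products whose component maps reflect membership in the base
group is injective. -/
theorem injective_of_reflects_range {ι : Type*} {G G' : ι → Type*} {H H' : Type*}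
    [∀ i, Group (G i)] [Group H] [∀ i, Group (G' i)] [Group H'] {φ : ∀ i, H →* G i}
    {φ' : ∀ i, H' →* G' i} (hφ : ∀ i, Function.Injective (φ i))
    (hφ' : ∀ i, Function.Injective (φ' i)) (ψ : ∀ i, G i →* G' i) (χ : H →* H')
    (hχ : Function.Injective χ)
    (hr : ∀ i g, ψ i g ∈ (φ' i).range → g ∈ (φ i).range) (F : PushoutI φ →* PushoutI φ')
    (hF : ∀ i g, F (of i g) = of i (ψ i g)) (hFb : ∀ h, F (base φ h) = base φ' (χ h)) :
    Function.Injective F := by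
  rw [injective_iff_map_eq_one]
  intro x hx
  obtain ⟨d⟩ := NormalWord.transversal_nonempty φ hφ
  obtain ⟨w, rfl⟩ := NormalWord.exists_prod_eq d x
  let w' : CoprodI.Word G' :=
    { toList := w.toList.map fun l => ⟨l.1, ψ l.1 l.2⟩
      ne_one := by
        intro l hl
        obtain ⟨l, hl', rfl⟩ := List.mem_map.mp hl
        intro h
        exact w.reduced l hl' (hr l.1 l.2 (by
          change ψ l.1 l.2 = 1 at h
          rw [h]; exact one_mem _))
      chain_ne := by
        rw [List.isChain_map]
        exact w.chain_ne }
  have hw' : Reduced φ' w' := by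
    rintro l hl
    obtain ⟨l, hl', rfl⟩ := List.mem_map.mp hl
    exact fun h => w.reduced l hl' (hr l.1 l.2 h)
  have hprod : F (ofCoprodI w.toWord.prod) = ofCoprodI w'.prod := by
    simp only [CoprodI.Word.prod, w', map_list_prod, List.map_map, Function.comp_def,
      ofCoprodI_of, hF]
  have h1 : F w.prod = base φ' (χ w.head) * ofCoprodI w'.prod := by
    rw [NormalWord.prod, map_mul, hFb, hprod]
  rw [h1] at hx
  have hempty := hw'.eq_empty_of_mem_range hφ' ⟨(χ w.head)⁻¹, by
    rw [map_inv]; exact inv_eq_of_mul_eq_one_right hx⟩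
  have hl : w.toList = [] := by
    have := congrArg CoprodI.Word.toList hempty
    simpa [w', CoprodI.Word.empty] using this
  have hwe : w.toWord = .empty := CoprodI.Word.ext hl
  have hh : w.head = 1 := by
    rw [hempty, CoprodI.Word.prod_empty, map_one, mul_one] at hx
    exact hχ (by simpa using base_injective hφ' (hx.trans (map_one _).symm))
  rw [NormalWord.prod, hwe, hh]
  simp

end Monoid.PushoutI

open Monoid

/-- The endomorphism `x ↦ x y² x³ ⋯ y¹⁰⁰`, `y ↦ y x² y³ ⋯ x¹⁰⁰` of the free group on two
letters. -/
def altEnd : FreeGroup Bool →* FreeGroup Bool :=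
  FreeGroup.lift fun e => altVal (.of e) (.of !e)

theorem FreeGroup.lift_mk_congr {α M : Type*} [Group M] {f g : α → M} (L : List (α × Bool))
    (h : ∀ l ∈ L, f l.1 = g l.1) : FreeGroup.lift f (.mk L) = FreeGroup.lift g (.mk L) := by
  rw [FreeGroup.lift_mk, FreeGroup.lift_mk]
  congr 1
  apply List.map_congr_left
  intro l hl
  rw [h l hl]

theorem altEnd_injective : Function.Injective altEnd := by
  have h1 := injective_lift_altFamily ()
  let q : Option Unit → Bool := fun o => o.elim false fun _ => true
  let q' : Bool → Option Unit := fun b => if b then some () else none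
  have hq : Function.Injective (FreeGroup.map q) :=
    Function.LeftInverse.injective (g := FreeGroup.map q') fun z => by
      rw [FreeGroup.map.comp]
      convert FreeGroup.map.id z using 2
      congr 1
      funext o
      rcases o with _ | _ <;> rfl
  have hi : Function.Injective (FreeGroup.map (Sum.inr : Bool → Unit ⊕ Bool)) :=
    FreeGroup.map_injective Sum.inr_injective
  have : altEnd = (FreeGroup.map q).comp ((FreeGroup.lift (altFamily ())).comp
      (FreeGroup.map Sum.inr)) := by
    ext (_ | _) <;> simp [altEnd, altFamily, map_altVal, q]
  rw [this]
  exact hq.comp (h1.comp hi)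

/-- Iterates of `altEnd`. -/
def altEndPow : ℕ → FreeGroup Bool →* FreeGroup Bool
  | 0 => .id _
  | k + 1 => (altEndPow k).comp altEnd

/-- A group with compatible homomorphisms from the free group on two letters, indexed by `X` and
by heights, in which the images of the letters along descending paths of length at most `d` are
free. -/
structure TreeModel {X : Type} (p : X → X) (d : ℕ) where
  U : Type
  Γ : Type
  [grp : Group Γ]
  h : ℤ → X → FreeGroup Bool →* Γ
  ρ : FreeGroup Bool →* Γ
  root : U
  path : ℕ → X → U
  F : U → Γ
  h_zero : ∀ v, h 0 v = ρ
  h_succ : ∀ k v, (h k v).comp altEnd = h (k + 1) (p v)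
  F_root : F root = ρ (.of true)
  F_path : ∀ k v, k ≤ d → F (path k v) = h (-k) v (.of true)
  path_inj : ∀ k k' v v', k ≤ d → k' ≤ d → path k v = path k' v' → k = k' ∧ (k ≠ 0 → v = v')
  free : Function.Injective (FreeGroup.lift fun o : Option U => o.elim (ρ (.of false)) F)

attribute [instance] TreeModel.grp

namespace TreeModel

variable {X : Type} (p : X → X)

/-- The isomorphism along which the HNN extension of the depth zero model is formed. -/
noncomputable def altEndEquiv : (⊤ : Subgroup (FreeGroup Bool)) ≃* altEnd.range :=
  Subgroup.topEquiv.trans (MonoidHom.ofInjective altEnd_injective)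

/-- The depth zero model. -/
noncomputable def zero : TreeModel p 0 where
  U := Unit
  Γ := HNNExtension (FreeGroup Bool) ⊤ altEnd.range altEndEquiv
  h k _ := (MulAut.conj (HNNExtension.t ^ k)).toMonoidHom.comp HNNExtension.of
  ρ := HNNExtension.of
  root := ()
  path _ _ := ()
  F _ := HNNExtension.of (.of true)
  h_zero v := by ext; simp
  h_succ k v := by
    have key : ∀ z : FreeGroup Bool, (HNNExtension.of (altEnd z) :
        HNNExtension (FreeGroup Bool) ⊤ altEnd.range altEndEquiv) =
        HNNExtension.t * HNNExtension.of z * HNNExtension.t⁻¹ := by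
      intro z
      have := HNNExtension.equiv_eq_conj (φ := altEndEquiv) ⟨z, trivial⟩
      exact this
    ext z
    simp [key, zpow_add, mul_assoc]
  F_root := rfl
  F_path k v hk := by
    obtain rfl : k = 0 := by omega
    simp
  path_inj k k' v v' h h' _ := ⟨by omega, by omega⟩
  free := by
    let q : Option Unit → Bool := fun o => o.elim false fun _ => true
    have hq : Function.Injective q := by
      rintro (_ | _) (_ | _) <;> simp [q]
    have := (HNNExtension.of_injective (φ := altEndEquiv)).comp (FreeGroup.map_injective hq)
    rw [← MonoidHom.coe_comp] at this
    refine (congrArg (fun h : _ →* _ => Function.Injective h) ?_).mpr this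
    ext (_ | _) <;> simp [q]

variable {p} {d : ℕ}

theorem ρ_injective (m : TreeModel p d) : Function.Injective m.ρ := by
  let q : Bool → Option m.U := fun b => if b then some m.root else none
  have hq : Function.Injective q := by
    rintro (_ | _) (_ | _) <;> simp [q]
  have := m.free.comp (FreeGroup.map_injective hq)
  rw [← MonoidHom.coe_comp] at this
  refine (congrArg (fun h : _ →* _ => Function.Injective h) ?_).mpr this
  ext (_ | _) <;> simp [q, m.F_root]

/-- The amalgamated family used to pass from depth `d` to depth `d + 1`. -/
def amalgam (m : TreeModel p d) (_ : X) : FreeGroup Bool →* m.Γ := m.ρ.comp altEnd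

theorem amalgam_injective (m : TreeModel p d) (v : X) : Function.Injective (m.amalgam v) :=
  m.ρ_injective.comp altEnd_injective

/-- The homomorphisms of the model of depth `d + 1`. -/
def stepHom (m : TreeModel p d) : ℤ → X → FreeGroup Bool →* PushoutI m.amalgam
  | .ofNat k, _ => (PushoutI.base m.amalgam).comp (altEndPow k)
  | .negSucc k, v => (PushoutI.of (φ := m.amalgam) (p^[k] v)).comp (m.h (-k) v)

/-- The paths of the model of depth `d + 1`. -/
def stepPath (m : TreeModel p d) : ℕ → X → Option (X × m.U)
  | 0, _ => none
  | k + 1, v => some (p^[k] v, m.path k v)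

/-- The letters of the model of depth `d + 1`. -/
def stepF (m : TreeModel p d) : Option (X × m.U) → PushoutI m.amalgam
  | none => PushoutI.base m.amalgam (.of true)
  | some (v, u) => PushoutI.of (φ := m.amalgam) v (m.F u)

theorem injective_lift_stepF (m : TreeModel p d) : Function.Injective (FreeGroup.lift
    fun o : Option (Option (X × m.U)) => o.elim (PushoutI.base m.amalgam (.of false)) m.stepF) := by
  let E : FreeGroup (Option m.U) →* m.Γ := FreeGroup.lift fun o => o.elim (m.ρ (.of false)) m.F
  let ψ : FreeGroup (m.U ⊕ Bool) →* m.Γ := E.comp (FreeGroup.lift (altFamily m.root))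
  have hψ : Function.Injective ψ := m.free.comp (injective_lift_altFamily m.root)
  let jB : X → FreeGroup Bool →* FreeGroup (m.U ⊕ Bool) := fun _ => FreeGroup.map Sum.inr
  have hjB : ∀ v, Function.Injective (jB v) := fun v => FreeGroup.map_injective Sum.inr_injective
  have hcompat : ∀ v, ψ.comp (jB v) = m.amalgam v := by
    intro v
    ext (_ | _) <;>
    simp [ψ, E, jB, amalgam, altEnd, altFamily, map_altVal, m.F_root]
  let Φ : PushoutI jB →* PushoutI m.amalgam :=
    PushoutI.lift (fun v => (PushoutI.of (φ := m.amalgam) v).comp ψ) (PushoutI.base m.amalgam)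
      (fun v => by rw [MonoidHom.comp_assoc, hcompat, PushoutI.of_comp_eq_base])
  have hΦ : Function.Injective Φ := by
    refine PushoutI.injective_of_reflects_range hjB m.amalgam_injective (fun _ => ψ) (.id _)
      Function.injective_id ?_ Φ ?_ ?_
    · rintro v g ⟨z, hz⟩
      exact ⟨z, hψ (by rw [← hz, ← hcompat v]; rfl)⟩
    · intro v g
      simp [Φ]
    · intro z
      simp [Φ]
  let a : FreeGroup (Option (Option (X × m.U))) →* PushoutI jB := FreeGroup.lift fun
    | none => PushoutI.base jB (.of false)
    | some none => PushoutI.base jB (.of true)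
    | some (some (v, u)) => PushoutI.of (φ := jB) v (.of (.inl u))
  let base' : FreeGroup Bool →* FreeGroup (Option (Option (X × m.U))) :=
    FreeGroup.lift fun b => if b then .of (some none) else .of none
  let a' : PushoutI jB →* FreeGroup (Option (Option (X × m.U))) :=
    PushoutI.lift (fun v => FreeGroup.lift fun
      | .inl u => .of (some (some (v, u)))
      | .inr b => base' (.of b)) base' (fun v => by ext; simp [jB])
  have ha : Function.Injective a := by
    refine Function.LeftInverse.injective (g := a') fun z => ?_
    have : a'.comp a = .id _ := by
      ext (_ | _ | ⟨v, u⟩) <;> simp [a, a', base']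
    exact DFunLike.congr_fun this z
  have := hΦ.comp ha
  rw [← MonoidHom.coe_comp] at this
  refine (congrArg (fun h : _ →* _ => Function.Injective h) ?_).mpr this
  ext (_ | _ | ⟨v, u⟩)
  · simp [a, Φ]
  · simp [a, Φ, stepF]
  · simp [a, Φ, stepF, ψ, E, altFamily]

theorem stepHom_negSucc (m : TreeModel p d) (k : ℕ) (v : X) :
    m.stepHom (.negSucc k) v = (PushoutI.of (φ := m.amalgam) (p^[k] v)).comp (m.h (-k) v) := rfl

theorem stepHom_succ (m : TreeModel p d) : ∀ (k : ℤ) (v : X),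
    (m.stepHom k v).comp altEnd = m.stepHom (k + 1) (p v)
  | .ofNat _, _ => rfl
  | .negSucc 0, v => by
    have h0 : m.h (-((0 : ℕ) : ℤ)) v = m.ρ := by rw [Nat.cast_zero, neg_zero, m.h_zero]
    rw [stepHom_negSucc, h0, MonoidHom.comp_assoc]
    exact PushoutI.of_comp_eq_base (φ := m.amalgam) v
  | .negSucc (k + 1), v => by
    have h0 : Int.negSucc (k + 1) + 1 = Int.negSucc k := rfl
    have h1 : -((k + 1 : ℕ) : ℤ) + 1 = -k := by push_cast; ring
    rw [h0, stepHom_negSucc, stepHom_negSucc, MonoidHom.comp_assoc, m.h_succ, h1,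
      Function.iterate_succ_apply]

theorem stepF_stepPath (m : TreeModel p d) : ∀ (k : ℕ) (v : X), k ≤ d + 1 →
    m.stepF (m.stepPath k v) = m.stepHom (-k) v (.of true)
  | 0, _, _ => rfl
  | k + 1, v, hk => by
    have h0 : -((k + 1 : ℕ) : ℤ) = Int.negSucc k := rfl
    rw [h0, stepHom_negSucc, MonoidHom.comp_apply, ← m.F_path k v (by omega)]
    rfl

theorem stepPath_inj (m : TreeModel p d) : ∀ (k k' : ℕ) (v v' : X), k ≤ d + 1 → k' ≤ d + 1 →
    m.stepPath k v = m.stepPath k' v' → k = k' ∧ (k ≠ 0 → v = v') := by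
  rintro (_ | k) (_ | k') v v' hk hk' h
  · simp
  · simp [stepPath] at h
  · simp [stepPath] at h
  · simp only [stepPath, Option.some.injEq, Prod.mk.injEq] at h
    obtain ⟨rfl, h2⟩ := m.path_inj k k' v v' (by omega) (by omega) h.2
    refine ⟨rfl, fun _ => ?_⟩
    rcases k with _ | k
    · exact h.1
    · exact h2 (by simp)

/-- The model of depth `d + 1` built from one of depth `d`. -/
def step (m : TreeModel p d) : TreeModel p (d + 1) where
  U := Option (X × m.U)
  Γ := PushoutI m.amalgam
  h := m.stepHom
  ρ := PushoutI.base m.amalgam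
  root := none
  path := m.stepPath
  F := m.stepF
  h_zero _ := rfl
  h_succ := m.stepHom_succ
  F_root := rfl
  F_path := m.stepF_stepPath
  path_inj := m.stepPath_inj
  free := m.injective_lift_stepF

/-- Models of every depth. -/
noncomputable def ofDepth (p : X → X) : (d : ℕ) → TreeModel p d
  | 0 => zero p
  | d + 1 => (ofDepth p d).step

end TreeModel

theorem FreeGroup.map_ne_one_of_injOn {α β : Type*} [DecidableEq α] (e : α → β) (w : FreeGroup α)
    (he : Set.InjOn e {v | v ∈ w.toWord.map Prod.fst}) (hw : w ≠ 1) : FreeGroup.map e w ≠ 1 := by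
  intro h
  have hne : w.toWord ≠ [] := by simpa using hw
  obtain ⟨l, hl⟩ := List.exists_mem_of_ne_nil _ hne
  have : Nonempty α := ⟨l.1⟩
  have h1 : FreeGroup.map (Function.invFunOn e {v | v ∈ w.toWord.map Prod.fst})
      (FreeGroup.map e w) = w := by
    rw [FreeGroup.map.comp]
    conv_rhs => rw [← FreeGroup.map.id w]
    rw [FreeGroup.map_eq_lift, FreeGroup.map_eq_lift, ← FreeGroup.mk_toWord (x := w)]
    apply FreeGroup.lift_mk_congr
    intro l hl
    rw [FreeGroup.mk_toWord] at *
    simp only [Function.comp_apply, id]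
    rw [he.leftInvOn_invFunOn (List.mem_map_of_mem hl)]
  rw [h, _root_.map_one] at h1
  exact hw h1.symm

/-- Free groups on a set with a height-increasing self-map `p` are separated by assignments
satisfying the symmetrised recursion along `p`. -/
theorem exists_alt_separating {X : Type} (p : X → X) (ht : X → ℤ) (hht : ∀ v, ht (p v) = ht v + 1)
    (w : FreeGroup X) (hw : w ≠ 1) : ∃ (N : Type) (_ : Group N) (f g : X → N),
      (∀ v, altVal (f v) (g v) = f (p v)) ∧ (∀ v, altVal (g v) (f v) = g (p v)) ∧
      FreeGroup.lift f w ≠ 1 := by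
  classical
  let S : Finset X := (w.toWord.map Prod.fst).toFinset
  have hS : ∀ v, v ∈ w.toWord.map Prod.fst → v ∈ S := fun v hv => List.mem_toFinset.mpr hv
  obtain ⟨n, hn⟩ : ∃ n : ℤ, ∀ v ∈ S, ht v < n := by
    obtain ⟨n, hn⟩ := (S.image ht).bddAbove
    exact ⟨n + 1, fun v hv => Int.lt_add_one_of_le (hn (by simpa using ⟨v, hv, rfl⟩))⟩
  obtain ⟨d, hd⟩ : ∃ d : ℕ, ∀ v ∈ S, (n - ht v).toNat ≤ d := by
    obtain ⟨d, hd⟩ := (S.image fun v => (n - ht v).toNat).bddAbove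
    exact ⟨d, fun v hv => hd (by simpa using ⟨v, hv, rfl⟩)⟩
  let m := TreeModel.ofDepth p d
  let e : X → m.U := fun v => m.path (n - ht v).toNat v
  have hf : ∀ b v, altVal (m.h (ht v - n) v (.of b)) (m.h (ht v - n) v (.of !b)) =
      m.h (ht (p v) - n) (p v) (.of b) := by
    intro b v
    rw [hht, show ht v + 1 - n = ht v - n + 1 by ring, ← m.h_succ]
    simp [altEnd, map_altVal]
  refine ⟨m.Γ, m.grp, fun v => m.h (ht v - n) v (.of true), fun v => m.h (ht v - n) v (.of false),
    hf true, hf false, ?_⟩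
  have he : Set.InjOn (some ∘ e) {v | v ∈ w.toWord.map Prod.fst} := by
    intro v hv v' hv' h
    have hv := hS v hv
    have hv' := hS v' hv'
    have h1 := (m.path_inj _ _ v v' (hd v hv) (hd v' hv') (Option.some.inj h)).2
    exact h1 (by have := hn v hv; omega)
  have hne := FreeGroup.map_ne_one_of_injOn (some ∘ e) w he hw
  have h2 : FreeGroup.lift (fun v => m.h (ht v - n) v (.of true)) w =
      FreeGroup.lift (fun o : Option m.U => o.elim (m.ρ (.of false)) m.F)
        (FreeGroup.map (some ∘ e) w) := by
    have h3 : FreeGroup.lift (fun o : Option m.U => o.elim (m.ρ (.of false)) m.F)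
        (FreeGroup.map (some ∘ e) w) = FreeGroup.lift (fun v => m.F (e v)) w := by
      rw [← MonoidHom.comp_apply]
      congr 1
      ext v
      simp
    rw [h3, ← FreeGroup.mk_toWord (x := w)]
    apply FreeGroup.lift_mk_congr
    intro l hl
    have hl := hS l.1 (List.mem_map_of_mem hl)
    have := hn _ hl
    rw [m.F_path _ _ (hd _ hl), Int.toNat_of_nonneg (by omega), neg_sub]
  rw [h2]
  exact fun h => hne (m.free (h.trans (map_one _).symm))

/-- The value of the word `x y x² y ⋯ x¹⁰⁰ y` in a group. -/
def uVal {M : Type*} [Group M] (x y : M) : M :=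
  ((List.range 100).map fun k => x ^ (k + 1) * y).prod

theorem map_uVal {M N : Type*} [Group M] [Group N] (f : M →* N) (x y : M) :
    f (uVal x y) = uVal (f x) (f y) := by
  simp [uVal, map_list_prod, Function.comp_def]

theorem uVal_one_left {M : Type*} [Group M] {y : M} (hy : y * y = 1) : uVal 1 y = 1 := by
  rw [uVal]
  simp only [one_pow, one_mul, List.map_const', List.length_range, List.prod_replicate]
  rw [show 100 = 2 * 50 by norm_num, pow_mul, pow_two, hy, one_pow]

theorem uVal_eq_altVal {M : Type*} [Group M] {x y : M} (hy : y * y = 1) :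
    uVal x y = altVal x (y * x * y) := by
  have hinv : y⁻¹ = y := inv_eq_of_mul_eq_one_right hy
  have hconj : ∀ k : ℕ, (y * x * y) ^ k = y * x ^ k * y := by
    intro k
    conv_lhs => rw [← hinv, hinv]
    have := conj_pow (i := k) (a := y) (b := x)
    rwa [hinv] at this
  have key : ∀ n : ℕ, ((List.range (2 * n)).map fun k => x ^ (k + 1) * y).prod =
      ((List.range n).map fun k => x ^ (2 * k + 1) * (y * x * y) ^ (2 * k + 2)).prod := by
    intro n
    induction n with
    | zero => rfl
    | succ n ih =>
      rw [show 2 * (n + 1) = 2 * n + 1 + 1 by ring, List.range_succ, List.range_succ,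
        List.range_succ, List.map_append, List.map_append, List.map_append, List.prod_append,
        List.prod_append, List.prod_append, ih]
      simp only [List.map_singleton, List.prod_singleton]
      rw [hconj (2 * n + 2)]
      simp only [mul_assoc]
  exact key 50

/-- The relators `u(v, b) = p v` and `b² = 1`. -/
def invRels {X : Type} (p : X → X) : Set (FreeGroup (Option X)) :=
  insert (.of none * .of none)
    (Set.range fun v => uVal (.of (some v)) (.of none) * (.of (some (p v)))⁻¹)

/-- The group presented by generators `X ∪ {b}` and relations `u(v, b) = p v`, `b² = 1`. -/
abbrev InvGroup {X : Type} (p : X → X) := PresentedGroup (invRels p)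

namespace InvGroup

variable {X : Type} (p : X → X)

/-- The involution. -/
def inv : InvGroup p := PresentedGroup.of none

/-- The inclusion of the free group on `X`. -/
def ofFree : FreeGroup X →* InvGroup p := FreeGroup.lift fun v => PresentedGroup.of (some v)

theorem inv_mul_inv : inv p * inv p = 1 := by
  have := PresentedGroup.one_of_mem (Set.mem_insert _ _ : _ ∈ invRels p)
  rw [map_mul] at this
  exact this

theorem uVal_ofFree (v : X) : uVal (ofFree p (.of v)) (inv p) = ofFree p (.of (p v)) := by
  have := PresentedGroup.one_of_mem
    (Set.mem_insert_of_mem _ (Set.mem_range_self v) : _ ∈ invRels p)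
  rw [map_mul, map_inv, mul_inv_eq_one, map_uVal] at this
  rw [ofFree, FreeGroup.lift_apply_of, FreeGroup.lift_apply_of]
  exact this

theorem ofFree_injective (ht : X → ℤ) (hht : ∀ v, ht (p v) = ht v + 1) :
    Function.Injective (ofFree p) := by
  rw [injective_iff_map_eq_one]
  intro w hw
  by_contra hne
  obtain ⟨N, _, f, g, hf, hg, h⟩ := exists_alt_separating p ht hht w hne
  let Q := (N × N) ⋊[MonoidHom.id (MulAut (N × N))] MulAut (N × N)
  let β : Q := SemidirectProduct.inr MulEquiv.prodComm
  let F : X → Q := fun v => SemidirectProduct.inl (f v, g v)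
  have hβ : β * β = 1 := by
    change SemidirectProduct.inr _ * SemidirectProduct.inr _ = 1
    rw [← map_mul]
    rw [show (MulEquiv.prodComm * MulEquiv.prodComm : MulAut (N × N)) = 1 from rfl, map_one]
  have hβ' : β⁻¹ = β := inv_eq_of_mul_eq_one_right hβ
  have hconj : ∀ v, β * F v * β = SemidirectProduct.inl (g v, f v) := by
    intro v
    have := SemidirectProduct.inl_aut (φ := MonoidHom.id (MulAut (N × N))) MulEquiv.prodComm
      (f v, g v)
    nth_rw 2 [← hβ']
    rw [map_inv] at this
    exact this.symm
  have hrel : ∀ v, uVal (F v) β = F (p v) := by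
    intro v
    rw [uVal_eq_altVal hβ, hconj]
    change altVal (SemidirectProduct.inl _) _ = SemidirectProduct.inl _
    rw [← map_altVal]
    congr 1
    apply Prod.ext
    · rw [← hf]
      exact map_altVal (MonoidHom.fst N N) _ _
    · rw [← hg]
      exact map_altVal (MonoidHom.snd N N) _ _
  let Φ : InvGroup p →* Q := PresentedGroup.toGroup (f := fun o => o.elim β F) (by
    rintro r (rfl | ⟨v, rfl⟩)
    · simpa using hβ
    · simp [map_uVal, hrel])
  have h1 : (Φ.comp (ofFree p)) w = SemidirectProduct.inl (FreeGroup.lift (fun v => (f v, g v)) w) := by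
    rw [← MonoidHom.comp_apply]
    congr 1
    ext v : 1
    simp [Φ, ofFree, F]
  rw [MonoidHom.comp_apply, hw, map_one] at h1
  have h2 := SemidirectProduct.inl_injective (h1.symm.trans (map_one _).symm)
  apply h
  have h3 : FreeGroup.lift f w = MonoidHom.fst N N (FreeGroup.lift (fun v => (f v, g v)) w) := by
    rw [← MonoidHom.comp_apply]
    congr 1
    ext v
    simp
  rw [h3, h2, map_one]

end InvGroup

/-- The relators `u(v, i) = act i v`. -/
def treeRels {X I : Type} (act : I → X → X) : Set (FreeGroup (X ⊕ I)) :=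
  Set.range fun q : X × I =>
    uVal (.of (.inl q.1)) (.of (.inr q.2)) * (.of (.inl (act q.2 q.1)))⁻¹

/-- The group presented by generators `X ∪ I` and relations `u(v, i) = act i v`. -/
abbrev TreeGroup {X I : Type} (act : I → X → X) := PresentedGroup (treeRels act)

namespace TreeGroup

variable {X I : Type} (act : I → X → X)

/-- The homomorphism from the free group on the vertices. -/
def ofVert : FreeGroup X →* TreeGroup act := FreeGroup.lift fun v => PresentedGroup.of (.inl v)

/-- The generator attached to a label. -/
def letter (i : I) : TreeGroup act := PresentedGroup.of (.inr i)

theorem uVal_ofVert (v : X) (i : I) :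
    uVal (ofVert act (.of v)) (letter act i) = ofVert act (.of (act i v)) := by
  have := PresentedGroup.one_of_mem (Set.mem_range_self (v, i) : _ ∈ treeRels act)
  rw [map_mul, map_inv, mul_inv_eq_one, map_uVal] at this
  rw [ofVert, FreeGroup.lift_apply_of, FreeGroup.lift_apply_of]
  exact this

variable {act}

/-- The universal property of a tree group. -/
def lift {Q : Type*} [Group Q] (f : X → Q) (g : I → Q)
    (h : ∀ v i, uVal (f v) (g i) = f (act i v)) : TreeGroup act →* Q :=
  PresentedGroup.toGroup (f := Sum.elim f g) (by
    rintro r ⟨⟨v, i⟩, rfl⟩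
    simp [map_uVal, h])

theorem lift_ofVert {Q : Type*} [Group Q] (f : X → Q) (g : I → Q)
    (h : ∀ v i, uVal (f v) (g i) = f (act i v)) (v : X) :
    lift f g h (ofVert act (.of v)) = f v := by
  simp [lift, ofVert]

theorem lift_letter {Q : Type*} [Group Q] (f : X → Q) (g : I → Q)
    (h : ∀ v i, uVal (f v) (g i) = f (act i v)) (i : I) :
    lift f g h (letter act i) = g i := by
  simp [lift, letter]

variable (act)

/-- The homomorphism to the amalgamated product of the groups `InvGroup (act i)`. -/
def toPushout : TreeGroup act →* PushoutI fun i => InvGroup.ofFree (act i) :=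
  lift (fun v => PushoutI.base (fun i => InvGroup.ofFree (act i)) (.of v))
    (fun i => PushoutI.of (φ := fun i => InvGroup.ofFree (act i)) i (InvGroup.inv (act i))) (by
    intro v i
    rw [← PushoutI.of_apply_eq_base (fun i => InvGroup.ofFree (act i)) i, ← map_uVal,
      InvGroup.uVal_ofFree]
    exact PushoutI.of_apply_eq_base (fun i => InvGroup.ofFree (act i)) i _)

theorem toPushout_comp_ofVert : (toPushout act).comp (ofVert act) =
    PushoutI.base fun i => InvGroup.ofFree (act i) := by
  ext v
  rw [MonoidHom.comp_apply, toPushout, lift_ofVert]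

theorem toPushout_letter (i : I) : toPushout act (letter act i) =
    PushoutI.of (φ := fun i => InvGroup.ofFree (act i)) i (InvGroup.inv (act i)) :=
  lift_letter _ _ _ i

theorem ofVert_injective (ht : I → X → ℤ) (hht : ∀ i v, ht i (act i v) = ht i v + 1) :
    Function.Injective (ofVert act) := by
  have h := PushoutI.base_injective (φ := fun i => InvGroup.ofFree (act i))
    fun i => InvGroup.ofFree_injective _ (ht i) (hht i)
  rw [← toPushout_comp_ofVert] at h
  exact Function.Injective.of_comp h

theorem eq_one_of_mem_range_letter (ht : I → X → ℤ)
    (hht : ∀ i v, ht i (act i v) = ht i v + 1) (w : FreeGroup X)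
    (hw : ofVert act w ∈ (FreeGroup.lift (letter act)).range) : w = 1 := by
  obtain ⟨m, hm⟩ := hw
  let R : Set (FreeGroup I) := Set.range fun i => .of i * .of i
  have hR : ∀ i, (PresentedGroup.of i * PresentedGroup.of i : PresentedGroup R) = 1 := by
    intro i
    have := PresentedGroup.one_of_mem (Set.mem_range_self i : _ ∈ R)
    rw [map_mul] at this
    exact this
  let χ : TreeGroup act →* PresentedGroup R := lift (fun _ => 1) PresentedGroup.of
    fun v i => uVal_one_left (hR i)
  let ξ : PresentedGroup R →* PushoutI fun i => InvGroup.ofFree (act i) :=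
    PresentedGroup.toGroup (f := fun i =>
      PushoutI.of (φ := fun i => InvGroup.ofFree (act i)) i (InvGroup.inv (act i))) (by
      rintro r ⟨i, rfl⟩
      simp only [map_mul, FreeGroup.lift_apply_of]
      rw [← map_mul, InvGroup.inv_mul_inv, map_one])
  have h1 : χ (ofVert act w) = 1 := by
    have : χ.comp (ofVert act) = 1 := by
      ext v
      simp [χ, lift_ofVert]
    exact DFunLike.congr_fun this w
  have h2 : ξ (χ (FreeGroup.lift (letter act) m)) =
      toPushout act (FreeGroup.lift (letter act) m) := by
    have : (ξ.comp χ).comp (FreeGroup.lift (letter act)) =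
        (toPushout act).comp (FreeGroup.lift (letter act)) := by
      ext i
      simp only [MonoidHom.comp_apply, FreeGroup.lift_apply_of, χ, toPushout_letter, lift_letter]
      simp [ξ]
    exact DFunLike.congr_fun this m
  rw [hm, h1, map_one] at h2
  have h3 := PushoutI.base_injective (φ := fun i => InvGroup.ofFree (act i))
    fun i => InvGroup.ofFree_injective _ (ht i) (hht i)
  apply h3
  rw [← toPushout_comp_ofVert, MonoidHom.comp_apply, ← h2, map_one]

end TreeGroup

/-- Subgroups of the factors of an amalgamated product which meet the amalgamated subgroup
trivially generate their free product. -/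
theorem Monoid.PushoutI.injective_coprodI_lift {ι : Type*} {G : ι → Type*} {H : Type*}
    [∀ i, Group (G i)] [Group H] {φ : ∀ i, H →* G i} (hφ : ∀ i, Function.Injective (φ i))
    (S : ∀ i, Subgroup (G i)) (hS : ∀ i h, φ i h ∈ S i → φ i h = 1) :
    Function.Injective
      (CoprodI.lift fun i => (PushoutI.of (φ := φ) i).comp (S i).subtype) := by
  classical
  rw [injective_iff_map_eq_one]
  intro x hx
  obtain ⟨w, rfl⟩ := CoprodI.Word.equiv.symm.surjective x
  change CoprodI.lift _ w.prod = 1 at hx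
  let w' : CoprodI.Word G :=
    { toList := w.toList.map fun l => ⟨l.1, l.2⟩
      ne_one := by
        intro l hl
        obtain ⟨l, hl', rfl⟩ := List.mem_map.mp hl
        intro h
        exact w.ne_one l hl' (Subtype.ext h)
      chain_ne := by
        rw [List.isChain_map]
        exact w.chain_ne }
  have hw' : PushoutI.Reduced φ w' := by
    rintro l hl
    obtain ⟨l, hl', rfl⟩ := List.mem_map.mp hl
    rintro ⟨h, hh⟩
    have := hS _ h (by rw [hh]; exact l.2.2)
    exact w.ne_one l hl' (Subtype.ext (hh.symm.trans this))
  have hprod : CoprodI.lift (fun i => (PushoutI.of (φ := φ) i).comp (S i).subtype) w.prod =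
      PushoutI.ofCoprodI w'.prod := by
    simp only [CoprodI.Word.prod, w', map_list_prod, List.map_map, Function.comp_def,
      PushoutI.ofCoprodI_of, CoprodI.lift_of]
    rfl
  have hempty := hw'.eq_empty_of_mem_range hφ (by rw [← hprod, hx]; exact one_mem _)
  have hl : w.toList = [] := by
    have := congrArg CoprodI.Word.toList hempty
    simpa [w', CoprodI.Word.empty] using this
  have hwe : w = .empty := CoprodI.Word.ext hl
  rw [hwe]
  exact CoprodI.Word.prod_empty

namespace DoubleInv

variable {X I : Type} (act : I → X → X) (q : X → X)

/-- A tree group together with two copies of a group with an involution. -/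
abbrev Fam : Option Bool → Type
  | none => TreeGroup act
  | some _ => InvGroup q

instance : ∀ o, Group (Fam act q o)
  | none => inferInstanceAs (Group (TreeGroup act))
  | some _ => inferInstanceAs (Group (InvGroup q))

/-- The inclusions of the free group on `X` into the factors. -/
def hom : ∀ o, FreeGroup X →* Fam act q o
  | none => TreeGroup.ofVert act
  | some _ => InvGroup.ofFree q

/-- The amalgamated product of a tree group and two copies of a group with an involution. -/
abbrev Double := PushoutI (hom act q)

/-- The inclusion of the tree group. -/
def ofTree : TreeGroup act →* Double act q := PushoutI.of (φ := hom act q) none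

/-- The two involutions. -/
def inv (c : Bool) : Double act q := PushoutI.of (φ := hom act q) (some c) (InvGroup.inv q)

theorem ofTree_ofVert (w : FreeGroup X) :
    ofTree act q (TreeGroup.ofVert act w) = PushoutI.base (hom act q) w :=
  PushoutI.of_apply_eq_base (hom act q) none w

theorem uVal_inv (c : Bool) (v : X) : uVal (ofTree act q (TreeGroup.ofVert act (.of v)))
    (inv act q c) = ofTree act q (TreeGroup.ofVert act (.of (q v))) := by
  rw [ofTree_ofVert, ofTree_ofVert, ← PushoutI.of_apply_eq_base (hom act q) (some c),
    ← PushoutI.of_apply_eq_base (hom act q) (some c), inv, ← map_uVal]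
  exact congrArg _ (InvGroup.uVal_ofFree q v)

variable {act q}
  (ht : I → X → ℤ) (hht : ∀ i v, ht i (act i v) = ht i v + 1)
  (htq : X → ℤ) (hhtq : ∀ v, htq (q v) = htq v + 1)
include hht hhtq

theorem hom_injective : ∀ o, Function.Injective (hom act q o)
  | none => TreeGroup.ofVert_injective act ht hht
  | some _ => InvGroup.ofFree_injective q htq hhtq

theorem ofTree_injective : Function.Injective (ofTree act q) :=
  PushoutI.of_injective (φ := hom act q) (hom_injective ht hht htq hhtq) none

/-- The subgroups generated by the letters, respectively the involutions. -/
def sub (act : I → X → X) (q : X → X) : ∀ o, Subgroup (Fam act q o)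
  | none => (FreeGroup.lift (TreeGroup.letter act)).range
  | some _ => Subgroup.zpowers (InvGroup.inv q)

theorem hom_eq_one_of_mem_sub : ∀ o h, hom act q o h ∈ sub act q o → hom act q o h = 1
  | none, h, hh => by
    rw [TreeGroup.eq_one_of_mem_range_letter act ht hht h hh, map_one]
  | some c, h, hh => by
    obtain ⟨k, hk⟩ := hh
    have h1 : hom act q (some c) (h ^ 2) = 1 := by
      rw [map_pow, ← hk]
      change (InvGroup.inv q ^ k) ^ 2 = 1
      rw [← zpow_natCast, zpow_comm, zpow_natCast, pow_two, InvGroup.inv_mul_inv, one_zpow]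
    have h2 : h ^ 2 = 1 :=
      hom_injective ht hht htq hhtq (some c) (h1.trans (map_one _).symm)
    rw [(pow_eq_one_iff_left (n := 2) (by norm_num)).mp h2, map_one]

/-- If a word in the letters and an involution evaluates to the same element of the tree group
for both involutions, then it evaluates to this element after killing the involution. -/
theorem eq_lift_elim_one {J : Type} (l : J → Option I) (w : FreeGroup J) (m : TreeGroup act)
    (h : ∀ c, FreeGroup.lift (fun j => (l j).elim (inv act q c)
      fun i => ofTree act q (TreeGroup.letter act i)) w = ofTree act q m) :
    m = FreeGroup.lift (fun j => (l j).elim 1 (TreeGroup.letter act)) w := by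
  have hinj := PushoutI.injective_coprodI_lift (hom_injective ht hht htq hhtq)
    (sub act q) (hom_eq_one_of_mem_sub ht hht htq hhtq)
  set E := CoprodI.lift fun i => (PushoutI.of (φ := hom act q) i).comp (sub act q i).subtype
    with hE
  let x : I → sub act q none := fun i =>
    ⟨TreeGroup.letter act i, .of i, FreeGroup.lift_apply_of⟩
  let y : ∀ c, sub act q (some c) := fun c => ⟨InvGroup.inv q, Subgroup.mem_zpowers _⟩
  let δ : Bool → FreeGroup J →* CoprodI fun o => sub act q o := fun c =>
    FreeGroup.lift fun j => (l j).elim (CoprodI.of (i := some c) (y c))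
      fun i => CoprodI.of (i := none) (x i)
  have hδ : ∀ c, E (δ c w) = ofTree act q m := by
    intro c
    rw [← h c, ← MonoidHom.comp_apply]
    congr 1
    ext j
    rcases hj : l j with _ | i
    · simp only [MonoidHom.comp_apply, FreeGroup.lift_apply_of, δ, hj, Option.elim, hE,
        CoprodI.lift_of]
      rfl
    · simp only [MonoidHom.comp_apply, FreeGroup.lift_apply_of, δ, hj, Option.elim, hE,
        CoprodI.lift_of]
      rfl
  have heq : δ true w = δ false w := hinj ((hδ true).trans (hδ false).symm)
  let κ : (CoprodI fun o => sub act q o) →* CoprodI fun o => sub act q o :=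
    CoprodI.lift fun
      | some false => 1
      | some true => CoprodI.of (M := fun o => sub act q o) (i := some true)
      | none => CoprodI.of (M := fun o => sub act q o) (i := none)
  let w' : sub act q none := FreeGroup.lift (fun j => (l j).elim 1 x) w
  have h1 : κ (δ true w) = δ true w := by
    rw [← MonoidHom.comp_apply]
    congr 1
    ext j
    rcases hj : l j with _ | i <;>
    simp [δ, hj, κ]
  have h2 : κ (δ false w) = CoprodI.of (i := none) w' := by
    have : κ.comp (δ false) = (CoprodI.of (i := none)).comp
        (FreeGroup.lift (fun j => (l j).elim 1 x)) := by
      ext j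
      rcases hj : l j with _ | i <;> simp [δ, hj, κ]
    exact DFunLike.congr_fun this w
  have h3 : E (δ true w) = ofTree act q w' := by
    rw [← h1, heq, h2, hE, CoprodI.lift_of]
    rfl
  have h4 : m = w' := ofTree_injective ht hht htq hhtq ((hδ true).symm.trans h3)
  rw [h4]
  change (sub act q none).subtype (FreeGroup.lift _ w) = _
  rw [← MonoidHom.comp_apply]
  congr 1
  ext j
  rcases hj : l j with _ | i
  · simp only [MonoidHom.comp_apply, FreeGroup.lift_apply_of, hj, Option.elim, map_one]
  · simp only [MonoidHom.comp_apply, FreeGroup.lift_apply_of, hj, Option.elim]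
    rfl

end DoubleInv

theorem FreeGroup.lift_mk_uWord {α : Type} {M : Type*} [Group M] (f : α → M) (x y : α) :
    FreeGroup.lift f (.mk (uWord x y)) = uVal (f x) (f y) := by
  rw [FreeGroup.lift_mk, uWord, uVal]
  rw [List.map_flatMap, List.flatMap, List.prod_flatten, List.map_map]
  congr 1
  apply List.map_congr_left
  intro k _
  simp

theorem FreeGroup.mk_uWord {α : Type} (x y : α) :
    (FreeGroup.mk (uWord x y)) = uVal (.of x) (.of y) := by
  rw [← FreeGroup.lift_mk_uWord, FreeGroup.lift_of_eq_id]
  rfl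

namespace Tree

variable {α : Type}

/-- The parent of a vertex. -/
def par : ℕ × List α → ℕ × List α
  | (n, []) => (n + 1, [])
  | (n, τ) => (n, τ.dropLast)

/-- The child of a vertex with a given label. -/
def child (l : α) (v : ℕ × List α) : ℕ × List α := (v.1, v.2 ++ [l])

/-- The embedding of the tree onto the subtree above the `l`-th child of `(0, [])` together with
the trunk below it. -/
def cut (l : α) : ℕ × List α → ℕ × List α
  | (0, τ) => (0, l :: τ)
  | (n + 1, τ) => (n, τ)

/-- Apply a function to all labels. -/
def relabel {β : Type} (f : α → β) (v : ℕ × List α) : ℕ × List β := (v.1, v.2.map f)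

theorem par_cut (l : α) : ∀ v : ℕ × List α, par (cut l v) = cut l (par v)
  | (0, []) => rfl
  | (0, _ :: _) => rfl
  | (_ + 1, []) => rfl
  | (_ + 1, _ :: _) => rfl

theorem child_cut (l k : α) : ∀ v : ℕ × List α, child k (cut l v) = cut l (child k v)
  | (0, _) => rfl
  | (_ + 1, _) => rfl

theorem par_relabel {β : Type} (f : α → β) :
    ∀ v : ℕ × List α, par (relabel f v) = relabel f (par v)
  | (_, []) => rfl
  | (_, _ :: _) => by simp [par, relabel]

theorem child_relabel {β : Type} (f : α → β) (k : α) (v : ℕ × List α) :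
    child (f k) (relabel f v) = relabel f (child k v) := by
  simp [child, relabel]

theorem height_par : ∀ v : ℕ × List α,
    ((par v).1 : ℤ) - (par v).2.length = (v.1 : ℤ) - v.2.length + 1
  | (n, []) => by simp [par]
  | (n, _ :: _) => by
    simp [par]
    ring

theorem height_child (k : α) (v : ℕ × List α) :
    ((child k v).2.length : ℤ) = v.2.length + 1 := by simp [child]

end Tree

theorem parent_eq (n : ℕ) (τ : List ℤ) : parent n τ = Tree.par (n, τ) := by
  cases τ <;> rfl

namespace K

/-- The vertices as elements of `K`. -/
def vert (v : ℕ × List ℤ) : K := PresentedGroup.of (.vert v.1 v.2)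

/-- The generator `a` of `K`. -/
def a : K := PresentedGroup.of .a

/-- The generators `bᵢ` of `K`. -/
def b (i : ℤ) : K := PresentedGroup.of (.b i)

theorem uVal_vert_a (v : ℕ × List ℤ) : uVal (vert v) a = vert (Tree.par v) := by
  have := PresentedGroup.one_of_mem (rels := KRels)
    (Set.mem_image_of_mem _ (Or.inl ⟨v.1, v.2, rfl⟩))
  rw [← FreeGroup.mul_mk, map_mul, FreeGroup.mk_uWord, map_uVal, parent_eq] at this
  exact mul_inv_eq_one.mp this

theorem uVal_vert_b (v : ℕ × List ℤ) (i : ℤ) :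
    uVal (vert v) (b i) = vert (Tree.child i v) := by
  have := PresentedGroup.one_of_mem (rels := KRels)
    (Set.mem_image_of_mem _ (Or.inr ⟨v.1, v.2, i, rfl⟩))
  rw [← FreeGroup.mul_mk, map_mul, FreeGroup.mk_uWord, map_uVal] at this
  exact mul_inv_eq_one.mp this

/-- The function on generators underlying `K.lift`. -/
def liftFun {Q : Type*} (f : ℕ × List ℤ → Q) (x : Q) (y : ℤ → Q) : KGen → Q
  | .vert n τ => f (n, τ)
  | .a => x
  | .b i => y i

theorem lift_liftFun_eq_one {Q : Type*} [Group Q] (f : ℕ × List ℤ → Q) (x : Q) (y : ℤ → Q)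
    (hx : ∀ v, uVal (f v) x = f (Tree.par v)) (hy : ∀ v i, uVal (f v) (y i) = f (Tree.child i v)) :
    ∀ r ∈ KRels, FreeGroup.lift (liftFun f x y) r = 1 := by
  rintro _ ⟨w, ⟨n, τ, rfl⟩ | ⟨n, τ, i, rfl⟩, rfl⟩
  · rw [← FreeGroup.mul_mk, map_mul, FreeGroup.lift_mk_uWord, parent_eq]
    have := hx (n, τ)
    simp [liftFun, this]
  · rw [← FreeGroup.mul_mk, map_mul, FreeGroup.lift_mk_uWord]
    have := hy (n, τ) i
    simp [liftFun, this, Tree.child]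

section lift

variable {Q : Type*} [Group Q] (f : ℕ × List ℤ → Q) (x : Q) (y : ℤ → Q)
  (hx : ∀ v, uVal (f v) x = f (Tree.par v)) (hy : ∀ v i, uVal (f v) (y i) = f (Tree.child i v))

/-- The universal property of `K`. -/
def lift : K →* Q := PresentedGroup.toGroup (lift_liftFun_eq_one f x y hx hy)

theorem lift_vert (v : ℕ × List ℤ) : lift f x y hx hy (vert v) = f v :=
  PresentedGroup.toGroup.of _

theorem lift_a : lift f x y hx hy a = x := PresentedGroup.toGroup.of _

theorem lift_b (i : ℤ) : lift f x y hx hy (b i) = y i := PresentedGroup.toGroup.of _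

end lift

theorem hom_ext {Q : Type*} [Group Q] {f g : K →* Q} (hv : ∀ v, f (vert v) = g (vert v))
    (ha : f a = g a) (hb : ∀ i, f (b i) = g (b i)) : f = g := by
  apply PresentedGroup.ext
  rintro (⟨n, τ⟩ | _ | i)
  · exact hv (n, τ)
  · exact ha
  · exact hb i

theorem eventually_of_gen {Q : Type*} [Group Q] {ι : Type*} {l : Filter ι} (F F' : ι → K →* Q)
    (hv : ∀ v, ∀ᶠ i in l, F i (vert v) = F' i (vert v)) (ha : ∀ᶠ i in l, F i a = F' i a)
    (hb : ∀ j, ∀ᶠ i in l, F i (b j) = F' i (b j)) (k : K) : ∀ᶠ i in l, F i k = F' i k := by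
  obtain ⟨w, rfl⟩ := PresentedGroup.mk_surjective _ k
  have hgen : ∀ x : KGen, ∀ᶠ i in l,
      F i (PresentedGroup.of x) = F' i (PresentedGroup.of x) := by
    rintro (⟨n, τ⟩ | _ | i)
    · exact hv (n, τ)
    · exact ha
    · exact hb i
  induction w using FreeGroup.induction_on with
  | C1 => simp
  | of x => exact hgen x
  | inv_of x hx =>
    filter_upwards [hgen x] with i hi
    rw [map_inv, map_inv, map_inv]
    exact congrArg _ hi
  | mul x y hx hy =>
    filter_upwards [hx, hy] with i hi hi'
    rw [map_mul, map_mul, map_mul, hi, hi']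

/-- The endomorphism of `K` induced by `Tree.cut i`. -/
def cut (i : ℤ) : K →* K :=
  lift (fun v => vert (Tree.cut i v)) a b
    (fun v => by rw [uVal_vert_a, Tree.par_cut]) (fun v j => by rw [uVal_vert_b, Tree.child_cut])

/-- The action of labels on the tree with the extra label `none` for children, in which the label
`none` acts by passing to the parent. -/
def act : Option ℤ → ℕ × List (Option ℤ) → ℕ × List (Option ℤ)
  | none => Tree.par
  | some j => Tree.child (some j)

/-- Height functions for `K.act`. -/
def height : Option ℤ → ℕ × List (Option ℤ) → ℤ
  | none, v => v.1 - v.2.length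
  | some _, v => v.2.length

theorem height_act : ∀ i v, height i (act i v) = height i v + 1
  | none, v => Tree.height_par v
  | some j, v => Tree.height_child (some j) v

/-- The homomorphism `TreeGroup.ofVert` on vertices. -/
def tvert (v : ℕ × List (Option ℤ)) : TreeGroup act := TreeGroup.ofVert act (.of v)

/-- The generic version of `K.cut`. -/
def genCut : K →* TreeGroup act :=
  lift (fun v => tvert (Tree.cut none (Tree.relabel some v))) (TreeGroup.letter act none)
    (fun i => TreeGroup.letter act (some i))
    (fun v => by
      rw [tvert, TreeGroup.uVal_ofVert, ← Tree.par_relabel, ← Tree.par_cut]; rfl)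
    (fun v i => by
      rw [tvert, TreeGroup.uVal_ofVert, ← Tree.child_relabel, ← Tree.child_cut]; rfl)

/-- A left inverse to `Tree.cut none ∘ Tree.relabel some`. -/
def uncut : ℕ × List (Option ℤ) → ℕ × List ℤ
  | (0, none :: τ) => (0, τ.map fun o => o.getD 0)
  | (n, τ) => (n + 1, τ.map fun o => o.getD 0)

theorem par_uncut : ∀ v, Tree.par (uncut v) = uncut (Tree.par v)
  | (0, []) => rfl
  | (0, [none]) => rfl
  | (0, none :: _ :: _) => by simp [Tree.par, uncut]
  | (0, [some _]) => rfl
  | (0, some _ :: _ :: _) => by simp [Tree.par, uncut]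
  | (_ + 1, []) => rfl
  | (_ + 1, _ :: _) => by simp [Tree.par, uncut]

theorem child_uncut (j : ℤ) : ∀ v, Tree.child j (uncut v) = uncut (Tree.child (some j) v)
  | (0, []) => rfl
  | (0, none :: _) => by simp [Tree.child, uncut]
  | (0, some _ :: _) => by simp [Tree.child, uncut]
  | (_ + 1, _) => by simp [Tree.child, uncut]

theorem uncut_cut : ∀ v : ℕ × List ℤ, uncut (Tree.cut none (Tree.relabel some v)) = v
  | (0, τ) => by simp [Tree.cut, Tree.relabel, uncut, Function.comp_def]
  | (1, []) => rfl
  | (1, _ :: _) => by simp [Tree.cut, Tree.relabel, uncut, Function.comp_def]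
  | (_ + 2, _) => by simp [Tree.cut, Tree.relabel, uncut, Function.comp_def]

/-- A left inverse to `K.genCut`. -/
def genUncut : TreeGroup act →* K :=
  TreeGroup.lift (fun v => vert (uncut v)) (fun o => o.elim a b) (by
    rintro v (_ | j)
    · exact (uVal_vert_a _).trans (congrArg vert (par_uncut v))
    · exact (uVal_vert_b _ _).trans (congrArg vert (child_uncut j v)))

theorem genUncut_genCut (k : K) : genUncut (genCut k) = k := by
  have : genUncut.comp genCut = .id K := by
    apply hom_ext
    · intro v
      simp only [MonoidHom.comp_apply, genCut, lift_vert, tvert, genUncut, TreeGroup.lift_ofVert,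
        uncut_cut, MonoidHom.id_apply]
    · simp only [MonoidHom.comp_apply, genCut, lift_a, genUncut, TreeGroup.lift_letter]
      rfl
    · intro i
      simp only [MonoidHom.comp_apply, genCut, lift_b, genUncut, TreeGroup.lift_letter]
      rfl
  exact DFunLike.congr_fun this k

theorem vert_injective : Function.Injective vert := by
  intro v v' h
  have h1 := congrArg genCut h
  simp only [genCut, lift_vert] at h1
  have h2 := FreeGroup.of_injective (TreeGroup.ofVert_injective act height height_act h1)
  rw [← uncut_cut v, h2, uncut_cut]

/-- The double over `K.act`. -/
abbrev Dbl := DoubleInv.Double act (Tree.child (none : Option ℤ))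

/-- Replace the label `i` by `none`. -/
def forget (i j : ℤ) : Option ℤ := if j = i then none else some j

/-- The homomorphism from `K` to the double which replaces the label `i` by the label of the
involution. -/
def toDbl (c : Bool) (i : ℤ) : K →* Dbl :=
  lift (fun v => DoubleInv.ofTree act _ (tvert (Tree.relabel (forget i) v)))
    (DoubleInv.ofTree act _ (TreeGroup.letter act none))
    (fun j => (forget i j).elim (DoubleInv.inv act _ c)
      fun k => DoubleInv.ofTree act _ (TreeGroup.letter act (some k)))
    (fun v => by
      rw [← map_uVal, tvert, TreeGroup.uVal_ofVert, ← Tree.par_relabel]; rfl)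
    (fun v j => by
      rw [← Tree.child_relabel]
      rcases forget i j with _ | k
      · exact DoubleInv.uVal_inv _ _ _ _
      · rw [Option.elim_some, ← map_uVal, tvert, TreeGroup.uVal_ofVert]
        rfl)

theorem eventually_toDbl_cut (c : Bool) (k : K) :
    ∀ᶠ i in Filter.cofinite, toDbl c i (cut i k) = DoubleInv.ofTree act _ (genCut k) := by
  have hne : ∀ j : ℤ, ∀ᶠ i in Filter.cofinite, forget i j = some j := by
    intro j
    filter_upwards [(Set.finite_singleton j).compl_mem_cofinite] with i hi
    exact if_neg fun h => hi h.symm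
  apply eventually_of_gen (fun i => (toDbl c i).comp (cut i))
    (fun _ => (DoubleInv.ofTree act _).comp genCut)
  · rintro ⟨n, τ⟩
    have h1 : ∀ᶠ i in Filter.cofinite, ∀ j ∈ τ, forget i j = some j :=
      (Filter.eventually_all_finite (List.finite_toSet τ)).mpr fun j _ => hne j
    filter_upwards [h1] with i hi
    have h2 : τ.map (forget i) = τ.map some := List.map_congr_left hi
    have h3 : forget i i = none := if_pos rfl
    simp only [MonoidHom.comp_apply, cut, genCut, lift_vert, toDbl]
    rcases n with _ | n
    · simp [Tree.cut, Tree.relabel, h2, h3]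
    · simp [Tree.cut, Tree.relabel, h2]
  · simp [cut, genCut, lift_a, toDbl]
  · intro j
    filter_upwards [hne j] with i hi
    simp [cut, genCut, lift_b, toDbl, hi]

/-- The subgroup generated by the `bᵢ`. -/
def bSub : Subgroup K := (FreeGroup.lift b).range

theorem b_mem_bSub (i : ℤ) : b i ∈ bSub := ⟨.of i, FreeGroup.lift_apply_of⟩

theorem eventually_mem_bSub (k : K) :
    ∀ᶠ i in Filter.cofinite, cut i k ∈ bSub → k ∈ bSub := by
  filter_upwards [eventually_toDbl_cut true k, eventually_toDbl_cut false k] with i ht hf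
  rintro ⟨w, hw⟩
  have h1 : ∀ c, FreeGroup.lift (fun j => ((forget i j).map some).elim (DoubleInv.inv act _ c)
      fun i => DoubleInv.ofTree act (Tree.child none) (TreeGroup.letter act i)) w =
      DoubleInv.ofTree act _ (genCut k) := by
    intro c
    have h2 : toDbl c i (cut i k) = DoubleInv.ofTree act _ (genCut k) := by
      cases c
      · exact hf
      · exact ht
    rw [← h2, ← hw, ← MonoidHom.comp_apply]
    congr 1
    ext j
    rcases hj : forget i j <;> simp [toDbl, lift_b, hj]
  have h2 := DoubleInv.eq_lift_elim_one height height_act (fun v => v.2.length)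
    (Tree.height_child none) _ w _ h1
  have h3 := congrArg genUncut h2
  rw [genUncut_genCut, ← MonoidHom.comp_apply] at h3
  have h4 : genUncut.comp (FreeGroup.lift fun j =>
      ((forget i j).map some).elim 1 (TreeGroup.letter act)) =
      (FreeGroup.lift b).comp (FreeGroup.lift fun j => (forget i j).elim 1 FreeGroup.of) := by
    ext j
    rcases hj : forget i j <;> simp [genUncut, TreeGroup.lift_letter, hj]
  rw [h4] at h3
  exact ⟨_, h3.symm⟩

end K

/-- A family of endomorphisms of an HNN extension which fix the stable letter and the associated
subgroup and eventually reflect membership in the associated subgroup is eventually nontrivial on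
any given nontrivial element. -/
theorem HNNExtension.eventually_map_ne_one {Γ ι : Type*} [Group Γ] {A : Subgroup Γ} {φ : A ≃* A}
    {l : Filter ι} (Ψ : ι → HNNExtension Γ A A φ →* HNNExtension Γ A A φ) (ψ : ι → Γ →* Γ)
    (hof : ∀ i g, Ψ i (of g) = of (ψ i g)) (ht : ∀ i, Ψ i t = t) (hfix : ∀ i, ∀ g ∈ A, ψ i g = g)
    (hmem : ∀ g, ∀ᶠ i in l, ψ i g ∈ A → g ∈ A) {x : HNNExtension Γ A A φ} (hx : x ≠ 1) :
    ∀ᶠ i in l, Ψ i x ≠ 1 := by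
  obtain ⟨d⟩ := NormalWord.TransversalPair.nonempty Γ A A
  obtain ⟨w, rfl⟩ := (NormalWord.equiv φ d).symm.surjective x
  change w.prod φ ≠ 1 at hx
  have hall : ∀ᶠ i in l, ∀ p ∈ w.toList, ψ i p.2 ∈ A → p.2 ∈ A :=
    (Filter.eventually_all_finite (List.finite_toSet w.toList)).mpr fun p _ => hmem p.2
  filter_upwards [hall, hmem w.head] with i hi hhead h
  change Ψ i (w.prod φ) = 1 at h
  have hsub : ∀ u : ℤˣ, toSubgroup A A u = A := by
    intro u
    rcases Int.units_eq_one_or u with rfl | rfl <;> rfl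
  let w' : NormalWord.ReducedWord Γ A A :=
    { head := ψ i w.head
      toList := w.toList.map fun p => (p.1, ψ i p.2)
      chain := by
        rw [List.isChain_map]
        refine w.chain.imp_of_mem_imp ?_
        intro p q hp _ hpq hp'
        rw [hsub] at hp' hpq
        exact hpq (hi p hp hp') }
  have hprod : w'.prod φ = Ψ i (w.prod φ) := by
    simp [w', NormalWord.ReducedWord.prod, map_list_prod, Function.comp_def, hof, ht]
  have hnil : w.toList = [] := by
    have := ReducedWord.toList_eq_nil_of_mem_of_range φ w' (by rw [hprod, h]; exact one_mem _)
    simpa [w'] using this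
  have hw : w.prod φ = of w.head := by simp [NormalWord.ReducedWord.prod, hnil]
  rw [hw, hof] at h
  have h1 : ψ i w.head = 1 := of_injective φ (h.trans (map_one _).symm)
  have h2 := hfix i _ (hhead (by rw [h1]; exact one_mem _))
  exact hx (by rw [hw, ← h2, h1, map_one])

namespace Tree

/-- The embedding of the tree onto the tree above the trunk from `(1, [])` on. -/
def up {α : Type} (v : ℕ × List α) : ℕ × List α := (v.1 + 1, v.2)

theorem par_up {α : Type} : ∀ v : ℕ × List α, par (up v) = up (par v)
  | (_, []) => rfl
  | (_, _ :: _) => rfl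

theorem child_up {α : Type} (k : α) (v : ℕ × List α) : child k (up v) = up (child k v) := rfl

theorem cut_up {α : Type} (l : α) (v : ℕ × List α) : cut l (up v) = v := rfl

end Tree

namespace K

theorem cut_vert (i : ℤ) (v : ℕ × List ℤ) : cut i (vert v) = vert (Tree.cut i v) := lift_vert ..

theorem cut_a (i : ℤ) : cut i a = a := lift_a ..

theorem cut_b (i j : ℤ) : cut i (b j) = b j := lift_b ..

theorem cut_of_mem_bSub (i : ℤ) {k : K} (hk : k ∈ bSub) : cut i k = k := by
  obtain ⟨w, rfl⟩ := hk
  rw [← MonoidHom.comp_apply]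
  congr 1
  ext j
  simp [cut_b]

/-- The endomorphism of `K` induced by `Tree.up`. -/
def up : K →* K :=
  lift (fun v => vert (Tree.up v)) a b
    (fun v => by rw [uVal_vert_a, Tree.par_up]) (fun v j => by rw [uVal_vert_b, Tree.child_up])

theorem cut_comp_up (i : ℤ) : (cut i).comp up = .id K := by
  apply hom_ext
  · intro v
    rw [MonoidHom.comp_apply, up, lift_vert, cut_vert, Tree.cut_up, MonoidHom.id_apply]
  · rw [MonoidHom.comp_apply, up, lift_a, cut_a, MonoidHom.id_apply]
  · intro j
    rw [MonoidHom.comp_apply, up, lift_b, cut_b, MonoidHom.id_apply]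

/-- The endomorphism of `K` which adds `c` to all labels. -/
def addLabel (c : ℤ) : K →* K :=
  lift (fun v => vert (Tree.relabel (· + c) v)) a (fun i => b (i + c))
    (fun v => by rw [uVal_vert_a, Tree.par_relabel])
    (fun v j => by rw [uVal_vert_b, ← Tree.child_relabel])

theorem addLabel_b (c i : ℤ) : addLabel c (b i) = b (i + c) := lift_b ..

theorem addLabel_addLabel {c c' : ℤ} (h : c' + c = 0) (k : K) :
    addLabel c (addLabel c' k) = k := by
  have : (addLabel c).comp (addLabel c') = .id K := by
    apply hom_ext
    · intro v
      simp [addLabel, lift_vert, Tree.relabel, Function.comp_def, add_assoc, h]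
    · simp [addLabel, lift_a]
    · intro j
      simp [addLabel_b, add_assoc, h]
  exact DFunLike.congr_fun this k

theorem addLabel_mem_bSub (c : ℤ) {k : K} (hk : k ∈ bSub) : addLabel c k ∈ bSub := by
  obtain ⟨w, rfl⟩ := hk
  refine ⟨FreeGroup.map (· + c) w, ?_⟩
  rw [← MonoidHom.comp_apply, ← MonoidHom.comp_apply]
  congr 1
  ext j
  simp [addLabel_b]

/-- The automorphism `bᵢ ↦ bᵢ₊₁` of the subgroup generated by the `bᵢ`. -/
def bShift : bSub ≃* bSub where
  toFun k := ⟨addLabel 1 k, addLabel_mem_bSub 1 k.2⟩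
  invFun k := ⟨addLabel (-1) k, addLabel_mem_bSub (-1) k.2⟩
  left_inv k := Subtype.ext (addLabel_addLabel (by simp) _)
  right_inv k := Subtype.ext (addLabel_addLabel (by simp) _)
  map_mul' k k' := Subtype.ext (map_mul _ _ _)

/-- The HNN extension of `K` along `bᵢ ↦ bᵢ₊₁`. -/
abbrev HNN := HNNExtension K bSub bSub bShift

/-- The endomorphism of the HNN extension induced by `K.cut`. -/
def hnnCut (i : ℤ) : HNN →* HNN :=
  HNNExtension.lift (HNNExtension.of.comp (cut i)) HNNExtension.t fun k => by
    rw [MonoidHom.comp_apply, MonoidHom.comp_apply, cut_of_mem_bSub i k.2,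
      cut_of_mem_bSub i (bShift k).2, HNNExtension.t_mul_of]

theorem eventually_hnnCut_ne_one {x : HNN} (hx : x ≠ 1) :
    ∀ᶠ i in Filter.cofinite, hnnCut i x ≠ 1 :=
  HNNExtension.eventually_map_ne_one hnnCut cut (fun _ _ => HNNExtension.lift_of ..)
    (fun _ => HNNExtension.lift_t ..) (fun i _ hk => cut_of_mem_bSub i hk) eventually_mem_bSub hx

end K

namespace G

/-- The canonical homomorphism from `K`. -/
def ofK : K →* G :=
  PresentedGroup.map (FreeGroup.map some) (by
    rintro _ ⟨w, hw, rfl⟩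
    exact ⟨_, Or.inl ⟨w, hw, rfl⟩, FreeGroup.map.mk.symm⟩)

theorem ofK_vert (v : ℕ × List ℤ) : ofK (K.vert v) = gvert v.1 v.2 := rfl

theorem ofK_a : ofK K.a = ga := rfl

theorem ofK_b (i : ℤ) : ofK (K.b i) = gb i := rfl

theorem conj_gb (i : ℤ) : gt' * gb i * gt'⁻¹ = gb (i + 1) := by
  have := PresentedGroup.one_of_mem (rels := GRels) (Set.mem_image_of_mem _ (Or.inr ⟨i, rfl⟩))
  exact mul_inv_eq_one.mp this

theorem hom_ext {Q : Type*} [Group Q] {f g : G →* Q} (hK : f.comp ofK = g.comp ofK)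
    (ht : f gt' = g gt') : f = g := by
  apply PresentedGroup.ext
  rintro (_ | x)
  · exact ht
  · exact DFunLike.congr_fun hK (PresentedGroup.of x)

section lift

variable {Q : Type*} [Group Q] (f : K →* Q) (s : Q)
  (h : ∀ i, s * f (K.b i) * s⁻¹ = f (K.b (i + 1)))

/-- The universal property of `G`. -/
def lift : G →* Q :=
  PresentedGroup.toGroup (f := fun o : GGen => o.elim s fun x => f (.of x)) (by
    rintro _ ⟨_, ⟨w, hw, rfl⟩ | ⟨i, rfl⟩, rfl⟩
    · have h1 : FreeGroup.lift (fun x => f (.of x)) = f.comp (PresentedGroup.mk KRels) := by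
        ext x
        simp [PresentedGroup.of]
      have h2 := DFunLike.congr_fun h1 (FreeGroup.mk w)
      rw [MonoidHom.comp_apply, PresentedGroup.one_of_mem (rels := KRels) (Set.mem_image_of_mem _ hw), map_one,
        FreeGroup.lift_mk] at h2
      rw [FreeGroup.lift_mk, List.map_map]
      exact h2
    · rw [FreeGroup.lift_mk]
      have := mul_inv_eq_one.mpr (h i)
      simpa [mul_assoc, K.b] using this)

theorem lift_ofK (k : K) : lift f s h (ofK k) = f k := by
  have : (lift f s h).comp ofK = f := by
    apply PresentedGroup.ext
    intro x
    change lift f s h (PresentedGroup.of (some x)) = _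
    exact PresentedGroup.toGroup.of _
  exact DFunLike.congr_fun this k

theorem lift_t : lift f s h gt' = s := PresentedGroup.toGroup.of _

end lift

/-- The homomorphism to the HNN extension. -/
def toHNN : G →* K.HNN :=
  lift HNNExtension.of HNNExtension.t fun i => by
    have := HNNExtension.equiv_eq_conj (φ := K.bShift) ⟨K.b i, K.b_mem_bSub i⟩
    rw [← this]
    exact congrArg HNNExtension.of (K.addLabel_b 1 i)

theorem gt_mul_ofK {k : K} (hk : k ∈ K.bSub) : gt' * ofK k = ofK (K.addLabel 1 k) * gt' := by
  obtain ⟨w, rfl⟩ := hk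
  rw [← mul_inv_eq_iff_eq_mul]
  have : (MulAut.conj gt').toMonoidHom.comp (ofK.comp (FreeGroup.lift K.b)) =
      (ofK.comp (K.addLabel 1)).comp (FreeGroup.lift K.b) := by
    ext i
    simp [K.addLabel_b, ofK_b, conj_gb]
  exact DFunLike.congr_fun this w

theorem toHNN_injective : Function.Injective toHNN := by
  let f : K.HNN →* G := HNNExtension.lift ofK gt' fun k => gt_mul_ofK k.2
  have : f.comp toHNN = .id G := by
    apply hom_ext
    · refine MonoidHom.ext fun k => ?_
      rw [MonoidHom.comp_apply, MonoidHom.comp_apply, toHNN, lift_ofK]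
      exact HNNExtension.lift_of ..
    · rw [MonoidHom.comp_apply, toHNN, lift_t]
      exact HNNExtension.lift_t ..
  exact Function.LeftInverse.injective (DFunLike.congr_fun this)

/-- The endomorphism of `G` induced by `K.cut`. -/
def cut (i : ℤ) : G →* G :=
  lift (ofK.comp (K.cut i)) gt' fun j => by
    simp only [MonoidHom.comp_apply, K.cut_b, ofK_b, conj_gb]

/-- The endomorphism of `G` induced by `K.up`. -/
def up : G →* G :=
  lift (ofK.comp K.up) gt' fun j => by
    simp only [MonoidHom.comp_apply, K.up, K.lift_b, ofK_b, conj_gb]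

theorem cut_up (i : ℤ) (g : G) : cut i (up g) = g := by
  have : (cut i).comp up = .id G := by
    apply hom_ext
    · refine MonoidHom.ext fun k => ?_
      simpa [cut, up, lift_ofK] using congrArg ofK (DFunLike.congr_fun (K.cut_comp_up i) k)
    · simp [cut, up, lift_t]
  exact DFunLike.congr_fun this g

theorem toHNN_cut (i : ℤ) (g : G) : toHNN (cut i g) = K.hnnCut i (toHNN g) := by
  have : toHNN.comp (cut i) = (K.hnnCut i).comp toHNN := by
    apply hom_ext
    · ext k
      simp [toHNN, cut, K.hnnCut, lift_ofK]
    · simp [toHNN, cut, K.hnnCut, lift_t]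
  exact DFunLike.congr_fun this g

theorem eventually_cut_ne_one {g : G} (hg : g ≠ 1) : ∀ᶠ i in Filter.cofinite, cut i g ≠ 1 := by
  filter_upwards [K.eventually_hnnCut_ne_one
    ((map_ne_one_iff toHNN toHNN_injective).mpr hg)] with i hi h
  rw [← toHNN_cut, h, map_one] at hi
  exact hi rfl

theorem gvert_injective {n n' : ℕ} {τ τ' : List ℤ} (h : gvert n τ = gvert n' τ') :
    (n, τ) = (n', τ') := by
  apply K.vert_injective
  apply HNNExtension.of_injective K.bShift
  have := congrArg toHNN h
  rw [← ofK_vert (n, τ), ← ofK_vert (n', τ'), toHNN, lift_ofK, lift_ofK] at this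
  exact this

theorem closure_eq_top : Subgroup.closure {gvert 0 [], ga, gb 0, gt'} = ⊤ := by
  set S := Subgroup.closure {gvert 0 [], ga, gb 0, gt'} with hS
  have hsub : {gvert 0 [], ga, gb 0, gt'} ⊆ (S : Set G) := Subgroup.subset_closure
  have ht : gt' ∈ S := hsub (by simp)
  have ha : ga ∈ S := hsub (by simp)
  have hu : ∀ {x y : G}, x ∈ S → y ∈ S → uVal x y ∈ S := by
    intro x y hx hy
    exact map_uVal S.subtype ⟨x, hx⟩ ⟨y, hy⟩ ▸ SetLike.coe_mem _
  have hb : ∀ i, gb i ∈ S := by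
    intro i
    induction i using Int.induction_on with
    | zero => exact hsub (by simp)
    | succ i hi => exact conj_gb i ▸ mul_mem (mul_mem ht hi) (inv_mem ht)
    | pred i hi =>
      have h1 := conj_gb (-(i : ℤ) - 1)
      rw [sub_add_cancel] at h1
      have h2 : gb (-(i : ℤ) - 1) = gt'⁻¹ * gb (-(i : ℤ)) * gt' := by
        rw [← h1]
        group
      exact h2 ▸ mul_mem (mul_mem (inv_mem ht) hi) ht
  have hpar : ∀ v, ofK (K.vert v) ∈ S → ofK (K.vert (Tree.par v)) ∈ S := by
    intro v hv
    rw [← K.uVal_vert_a, map_uVal]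
    exact hu hv ha
  have hchild : ∀ v i, ofK (K.vert v) ∈ S → ofK (K.vert (Tree.child i v)) ∈ S := by
    intro v i hv
    rw [← K.uVal_vert_b, map_uVal]
    exact hu hv (hb i)
  have hv : ∀ n τ, ofK (K.vert (n, τ)) ∈ S := by
    intro n τ
    induction τ using List.reverseRecOn with
    | nil =>
      induction n with
      | zero => exact hsub (by simp [ofK_vert])
      | succ n hn => exact hpar _ hn
    | append_singleton τ i hτ => exact hchild _ i hτ
  rw [eq_top_iff]
  intro g _
  apply PresentedGroup.generated_by
  rintro (_ | n | _ | i)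
  · exact ht
  · exact hv _ _
  · exact ha
  · exact hb _

theorem range_up : up.range = H := by
  rw [MonoidHom.range_eq_map, ← closure_eq_top, MonoidHom.map_closure, H]
  congr 1
  simp only [Set.image_insert_eq, Set.image_singleton]
  rw [← ofK_vert (0, []), ← ofK_a, ← ofK_b]
  simp only [up, lift_ofK, lift_t, MonoidHom.comp_apply, K.up, K.lift_vert, K.lift_a, K.lift_b]
  rfl

theorem up_injective : Function.Injective up := Function.LeftInverse.injective (cut_up 0)

theorem up_mem (g : G) : up g ∈ H := range_up ▸ ⟨g, rfl⟩

theorem up_cut_of_mem (i : ℤ) {g : G} (hg : g ∈ H) : up (cut i g) = g := by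
  rw [← range_up] at hg
  obtain ⟨g, rfl⟩ := hg
  rw [cut_up]

theorem existentiallyClosedSubgroup_H : ExistentiallyClosedSubgroup H := by
  rintro k m h P N ⟨g, hP, hN⟩
  obtain ⟨i, hi⟩ := ((Filter.eventually_all_finset N).mpr fun w hw =>
    eventually_cut_ne_one (hN w hw)).exists
  have key : ∀ w, FreeGroup.lift
      (Sum.elim (fun j => (h j : G)) (fun j => up (cut i (g j)))) w =
      up (cut i (FreeGroup.lift (Sum.elim (fun j => (h j : G)) g) w)) := by
    intro w
    rw [← MonoidHom.comp_apply, ← MonoidHom.comp_apply]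
    congr 1
    ext (j | j)
    · simp [up_cut_of_mem i (h j).2]
    · simp
  refine ⟨fun j => ⟨up (cut i (g j)), up_mem _⟩, fun w hw => ?_, fun w hw h1 => ?_⟩
  · rw [key, hP w hw, map_one, map_one]
  · rw [key, map_eq_one_iff up up_injective] at h1
    exact hi w hw h1

theorem H_ne_top : H ≠ ⊤ := by
  intro h
  have h0 : gvert 0 [] ∈ H := h ▸ Subgroup.mem_top _
  rw [← range_up] at h0
  obtain ⟨g, hg⟩ := h0
  have h1 : ∀ i, g = gvert 0 [i] := by
    intro i
    rw [← cut_up i g, hg, ← ofK_vert (0, []), cut, lift_ofK, MonoidHom.comp_apply, K.cut_vert]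
    rfl
  simpa using gvert_injective ((h1 0).symm.trans (h1 1))

end G

/-- `G` is self-reflective: it is finitely generated and `H` is a proper subgroup of `G`
isomorphic to `G` and existentially closed in `G`. -/
theorem stmt2 : Group.FG G ∧ H ≠ ⊤ ∧ Nonempty (H ≃* G) ∧ ExistentiallyClosedSubgroup H := by
  refine ⟨?_, G.H_ne_top, ?_, G.existentiallyClosedSubgroup_H⟩
  · exact Group.fg_iff.mpr ⟨_, G.closure_eq_top, by simp⟩
  · exact ⟨((MonoidHom.ofInjective G.up_injective).trans
      (MulEquiv.subgroupCongr G.range_up)).symm⟩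
end

section
/- H is existentially closed in G. -/
/-- The product `g h² g³ h⁴ ⋯ h¹⁰⁰`. -/
def altProd {M : Type*} [Monoid M] (g h : M) : M :=
  ((List.range 100).map fun k => (if k % 2 = 0 then g else h) ^ (k + 1)).prod

theorem map_altProd {M N : Type*} [Monoid M] [Monoid N] (f : M →* N) (g h : M) :
    f (altProd g h) = altProd (f g) (f h) := by
  simp only [altProd, map_list_prod, List.map_map]
  congr 2
  funext k
  simp only [Function.comp_apply, map_pow]
  split_ifs <;> rfl

namespace PingPong

/-- The irrational numbers. -/
abbrev Irr := {z : ℝ // Irrational z}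

/-- Translation by `2` on the irrational numbers. -/
def shift : Equiv.Perm Irr where
  toFun z := ⟨z.1 + 2, by simpa using z.2.add_natCast 2⟩
  invFun z := ⟨z.1 - 2, by simpa using z.2.sub_natCast 2⟩
  left_inv z := by ext; simp
  right_inv z := by ext; simp

/-- Inversion on the irrational numbers. -/
noncomputable def recip : Equiv.Perm Irr where
  toFun z := ⟨z.1⁻¹, z.2.inv⟩
  invFun z := ⟨z.1⁻¹, z.2.inv⟩
  left_inv z := by ext; simp
  right_inv z := by ext; simp

/-- Translation by `2`, conjugated by inversion. -/
noncomputable def coshift : Equiv.Perm Irr := recip * shift * recip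

theorem shift_pow (n : ℕ) (z : Irr) : ((shift ^ n) z).1 = z.1 + 2 * n := by
  induction n with
  | zero => simp
  | succ n ih =>
    rw [pow_succ']
    change ((shift ^ n) z).1 + 2 = _
    rw [ih]; push_cast; ring

theorem shift_pow_inv (n : ℕ) (z : Irr) : ((shift ^ n)⁻¹ z).1 = z.1 - 2 * n := by
  have := shift_pow n ((shift ^ n)⁻¹ z)
  rw [← Equiv.Perm.mul_apply, mul_inv_cancel] at this
  simp only [Equiv.Perm.coe_one, id_eq] at this
  linarith

theorem coshift_pow (n : ℕ) (z : Irr) : ((coshift ^ n) z).1⁻¹ = z.1⁻¹ + 2 * n := by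
  induction n with
  | zero => simp
  | succ n ih =>
    rw [pow_succ']
    change ((((coshift ^ n) z).1⁻¹ + 2)⁻¹)⁻¹ = _
    rw [ih, inv_inv]; push_cast; ring

theorem coshift_pow_inv (n : ℕ) (z : Irr) : ((coshift ^ n)⁻¹ z).1⁻¹ = z.1⁻¹ - 2 * n := by
  have := coshift_pow n ((coshift ^ n)⁻¹ z)
  rw [← Equiv.Perm.mul_apply, mul_inv_cancel] at this
  simp only [Equiv.Perm.coe_one, id_eq] at this
  linarith

/-- The product of the elements `g ^ p * h ^ q` over a list of pairs `(p, q)`. -/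
def syllProd {M : Type*} [Monoid M] (g h : M) (L : List (ℕ × ℕ)) : M :=
  (L.map fun p => g ^ p.1 * h ^ p.2).prod

theorem syllProd_cons {M : Type*} [Monoid M] (g h : M) (p : ℕ × ℕ) (L : List (ℕ × ℕ)) :
    syllProd g h (p :: L) = g ^ p.1 * h ^ p.2 * syllProd g h L := by
  simp [syllProd]

theorem map_syllProd {M N : Type*} [Monoid M] [Monoid N] (f : M →* N) (g h : M)
    (L : List (ℕ × ℕ)) : f (syllProd g h L) = syllProd (f g) (f h) L := by
  simp [syllProd, map_list_prod, List.map_map, Function.comp_def]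

theorem Irr.ne_int (z : Irr) (n : ℤ) : z.1 ≠ n := fun h => z.2 ⟨n, by simpa using h.symm⟩

theorem one_lt_syllProd (L : List (ℕ × ℕ)) (hL : ∀ p ∈ L, 1 ≤ p.1) (p q : ℕ) (hp : 1 ≤ p)
    (z : Irr) (hz : z.1⁻¹ ∉ Set.Ioo (-2 * q - 1 : ℝ) (-2 * q)) :
    1 < ((syllProd shift coshift (L ++ [(p, q)])) z).1 := by
  induction L with
  | nil =>
    simp only [syllProd, List.nil_append, List.map_cons, List.map_nil, List.prod_cons,
      List.prod_nil, mul_one, Equiv.Perm.mul_apply, shift_pow]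
    have h1 := coshift_pow q z
    set y := (coshift ^ q) z
    have hp' : (1 : ℝ) ≤ p := by exact_mod_cast hp
    have hy : -1 < y.1 := by
      by_contra hlt
      rw [not_lt] at hlt
      have hy1 : y.1 ≠ -1 := by simpa using Irr.ne_int y (-1)
      have hlt' : y.1 < -1 := lt_of_le_of_ne hlt hy1
      have h2 : y.1⁻¹ < 0 := by rw [inv_lt_zero]; linarith
      have h3 : -1 < y.1⁻¹ := by
        have := mul_inv_cancel₀ (show y.1 ≠ 0 by intro h; linarith)
        nlinarith
      exact hz ⟨by linarith, by linarith⟩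
    linarith
  | cons r L ih =>
    have ih := ih fun p hp => hL p (List.mem_cons_of_mem _ hp)
    have hr : (1 : ℝ) ≤ r.1 := by exact_mod_cast hL r List.mem_cons_self
    rw [List.cons_append, syllProd_cons]
    simp only [Equiv.Perm.mul_apply, shift_pow]
    have h1 := coshift_pow r.2 (syllProd shift coshift (L ++ [(p, q)]) z)
    have h2 : 0 < (syllProd shift coshift (L ++ [(p, q)]) z).1⁻¹ := by rw [inv_pos]; linarith
    have h3 : 0 < ((coshift ^ r.2) (syllProd shift coshift (L ++ [(p, q)]) z)).1 := by
      rw [← inv_pos, h1]; positivity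
    linarith

theorem syllProd_inv_mem (L : List (ℕ × ℕ)) (hL : ∀ p ∈ L, 1 ≤ p.1) (p q : ℕ) (hp : 1 ≤ p)
    (z : Irr) (hz : z.1 < 1) :
    ((syllProd shift coshift (L ++ [(p, q)]))⁻¹ z).1⁻¹ ∈ Set.Ioo (-2 * q - 1 : ℝ) (-2 * q) := by
  have key : ∀ (p q : ℕ), 1 ≤ p → ∀ z : Irr, z.1 < 1 →
      ((coshift ^ q)⁻¹ ((shift ^ p)⁻¹ z)).1⁻¹ ∈ Set.Ioo (-2 * q - 1 : ℝ) (-2 * q) := by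
    intro p q hp z hz
    have hp' : (1 : ℝ) ≤ p := by exact_mod_cast hp
    rw [coshift_pow_inv, shift_pow_inv]
    have h1 : z.1 - 2 * p < -1 := by linarith
    have h2 : (z.1 - 2 * p)⁻¹ < 0 := by rw [inv_lt_zero]; linarith
    have h3 : -1 < (z.1 - 2 * p)⁻¹ := by
      have := mul_inv_cancel₀ (show z.1 - 2 * p ≠ 0 by intro h; linarith)
      nlinarith
    exact ⟨by linarith, by linarith⟩
  induction L generalizing z with
  | nil =>
    simp only [syllProd, List.nil_append, List.map_cons, List.map_nil, List.prod_cons,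
      List.prod_nil, mul_one, mul_inv_rev, Equiv.Perm.mul_apply]
    exact key p q hp z hz
  | cons r L ih =>
    rw [List.cons_append, syllProd_cons]
    simp only [mul_inv_rev, Equiv.Perm.mul_apply]
    refine ih (fun p hp => hL p (List.mem_cons_of_mem _ hp)) _ ?_
    have h1 := key r.1 r.2 (hL r List.mem_cons_self) z hz
    have h2 : ((coshift ^ r.2)⁻¹ ((shift ^ r.1)⁻¹ z)).1 < 0 := by
      rw [← inv_lt_zero]
      have := h1.2
      have : (0 : ℝ) ≤ r.2 := by positivity
      linarith
    linarith

theorem coshift_syllProd_mem (L : List (ℕ × ℕ)) (hL : ∀ p ∈ L, 1 ≤ p.1) (p q q₀ : ℕ) (hp : 1 ≤ p)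
    (z : Irr) (hz : z.1⁻¹ ∉ Set.Ioo (-2 * q - 1 : ℝ) (-2 * q)) :
    ((coshift ^ q₀ * syllProd shift coshift (L ++ [(p, q)])) z).1⁻¹ ∈
      Set.Ioo (2 * q₀ : ℝ) (2 * q₀ + 1) := by
  have h := one_lt_syllProd L hL p q hp z hz
  rw [Equiv.Perm.mul_apply, coshift_pow]
  have h1 := inv_lt_one_of_one_lt₀ h
  have h2 := inv_pos.2 (zero_lt_one.trans h)
  exact ⟨by linarith, by linarith⟩

theorem coshift_syllProd_inv_mem (L : List (ℕ × ℕ)) (hL : ∀ p ∈ L, 1 ≤ p.1) (p q q₀ : ℕ)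
    (hp : 1 ≤ p) (z : Irr) (hz : z.1⁻¹ ∉ Set.Ioo (2 * q₀ : ℝ) (2 * q₀ + 1)) :
    ((coshift ^ q₀ * syllProd shift coshift (L ++ [(p, q)]))⁻¹ z).1⁻¹ ∈
      Set.Ioo (-2 * q - 1 : ℝ) (-2 * q) := by
  rw [mul_inv_rev, Equiv.Perm.mul_apply]
  refine syllProd_inv_mem L hL p q hp _ ?_
  have h1 := coshift_pow_inv q₀ z
  set y := (coshift ^ q₀)⁻¹ z
  by_contra hlt
  rw [not_lt] at hlt
  have hy1 : y.1 ≠ 1 := by simpa using Irr.ne_int y 1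
  have hlt' : 1 < y.1 := lt_of_le_of_ne hlt hy1.symm
  have h2 := inv_lt_one_of_one_lt₀ hlt'
  have h3 := inv_pos.2 (zero_lt_one.trans hlt')
  exact hz ⟨by linarith, by linarith⟩

/-- The two words `h² g³ h⁴ ⋯ h¹⁰⁰` and `h g² h³ ⋯ h⁹⁹`. -/
def trimmed {M : Type*} [Monoid M] (g h : M) : Bool → M
  | false => h ^ 2 * syllProd g h ((List.range 48).map (fun j => (2 * j + 3, 2 * j + 4)) ++ [(99, 100)])
  | true => h ^ 1 * syllProd g h ((List.range 48).map (fun j => (2 * j + 2, 2 * j + 3)) ++ [(98, 99)])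

theorem map_trimmed {M N : Type*} [Monoid M] [Monoid N] (f : M →* N) (g h : M) (b : Bool) :
    f (trimmed g h b) = trimmed (f g) (f h) b := by
  cases b <;> simp only [trimmed, map_mul, map_pow, map_syllProd]

theorem altProd_eq_mul_trimmed {M : Type*} [Monoid M] (g h : M) :
    altProd g h = g * trimmed g h false := by
  simp [altProd, trimmed, syllProd, List.range_succ, mul_assoc]

theorem altProd_eq_trimmed_mul {M : Type*} [Monoid M] (g h : M) :
    altProd h g = trimmed g h true * g ^ 100 := by
  simp [altProd, trimmed, syllProd, List.range_succ, mul_assoc]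

open Pointwise in
theorem injective_lift_shift_trimmed :
    Function.Injective (FreeGroup.lift fun o : Option Bool =>
      o.elim shift (trimmed shift coshift)) := by
  have hL1 : ∀ p ∈ (List.range 48).map (fun j => (2 * j + 3, 2 * j + 4)), 1 ≤ p.1 := by
    intro p hp
    obtain ⟨j, -, rfl⟩ := List.mem_map.1 hp
    simp
  have hL2 : ∀ p ∈ (List.range 48).map (fun j => (2 * j + 2, 2 * j + 3)), 1 ≤ p.1 := by
    intro p hp
    obtain ⟨j, -, rfl⟩ := List.mem_map.1 hp
    simp
  let X : Option Bool → Set Irr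
    | none => {z | 1 < z.1}
    | some false => {z | z.1⁻¹ ∈ Set.Ioo (4 : ℝ) 5}
    | some true => {z | z.1⁻¹ ∈ Set.Ioo (2 : ℝ) 3}
  let Y : Option Bool → Set Irr
    | none => {z | z.1 < -1}
    | some false => {z | z.1⁻¹ ∈ Set.Ioo (-201 : ℝ) (-200)}
    | some true => {z | z.1⁻¹ ∈ Set.Ioo (-199 : ℝ) (-198)}
  have hinv : ∀ z : ℝ, 1 < z → 0 < z⁻¹ ∧ z⁻¹ < 1 := fun z hz =>
    ⟨inv_pos.2 (zero_lt_one.trans hz), inv_lt_one_of_one_lt₀ hz⟩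
  have hinv' : ∀ z : ℝ, z < -1 → z⁻¹ < 0 ∧ -1 < z⁻¹ := fun z hz => by
    have := hinv (-z) (by linarith)
    rw [inv_neg] at this
    constructor <;> linarith
  refine FreeGroup.injective_lift_of_ping_pong _ X Y ?_ ?_ ?_ ?_ ?_ ?_
  · have hirr : ∀ a : ℝ, ∃ z : Irr, z.1 ∈ Set.Ioo a (a + 1) := fun a => by
      obtain ⟨r, hr, h1, h2⟩ := exists_irrational_btwn (show a < a + 1 by linarith)
      exact ⟨⟨r, hr⟩, h1, h2⟩
    rintro (_ | _ | _)
    · obtain ⟨z, hz⟩ := hirr 1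
      exact ⟨z, hz.1⟩
    · obtain ⟨z, hz⟩ := hirr 4
      refine ⟨recip z, ?_⟩
      change z.1⁻¹⁻¹ ∈ Set.Ioo (4 : ℝ) 5
      rw [inv_inv]; norm_num at hz ⊢; exact hz
    · obtain ⟨z, hz⟩ := hirr 2
      refine ⟨recip z, ?_⟩
      change z.1⁻¹⁻¹ ∈ Set.Ioo (2 : ℝ) 3
      rw [inv_inv]; norm_num at hz ⊢; exact hz
  · intro i j hij
    refine Set.disjoint_left.2 fun z hz hz' => ?_
    rcases i with (_ | _ | _) <;> rcases j with (_ | _ | _) <;> first | exact hij rfl | skip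
    all_goals simp only [X, Set.mem_ofPred_eq, Set.mem_Ioo] at hz hz'
    all_goals first
      | linarith [hz.1, hz.2, hz'.1, hz'.2]
      | linarith [(hinv _ hz).1, (hinv _ hz).2, hz'.1, hz'.2]
      | linarith [(hinv _ hz').1, (hinv _ hz').2, hz.1, hz.2]
  · intro i j hij
    refine Set.disjoint_left.2 fun z hz hz' => ?_
    rcases i with (_ | _ | _) <;> rcases j with (_ | _ | _) <;> first | exact hij rfl | skip
    all_goals simp only [Y, Set.mem_ofPred_eq, Set.mem_Ioo] at hz hz'
    all_goals first
      | linarith [hz.1, hz.2, hz'.1, hz'.2]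
      | linarith [(hinv' _ hz).1, (hinv' _ hz).2, hz'.1, hz'.2]
      | linarith [(hinv' _ hz').1, (hinv' _ hz').2, hz.1, hz.2]
  · intro i j
    refine Set.disjoint_left.2 fun z hz hz' => ?_
    rcases i with (_ | _ | _) <;> rcases j with (_ | _ | _)
    all_goals simp only [X, Y, Set.mem_ofPred_eq, Set.mem_Ioo] at hz hz'
    all_goals first
      | linarith
      | linarith [hz.1, hz.2, hz'.1, hz'.2]
      | linarith [(hinv _ hz).1, (hinv _ hz).2, hz'.1, hz'.2]
      | linarith [(hinv' _ hz').1, (hinv' _ hz').2, hz.1, hz.2]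
  · rintro (_ | _ | _) _ ⟨z, hz, rfl⟩
    · have hz1 : z.1 ≠ -1 := by simpa using Irr.ne_int z (-1)
      have hz2 : ¬ z.1 < -1 := hz
      change 1 < z.1 + 2
      have := lt_of_le_of_ne (not_lt.1 hz2) hz1.symm
      linarith
    · change (trimmed shift coshift false z).1⁻¹ ∈ Set.Ioo (4 : ℝ) 5
      have := coshift_syllProd_mem _ hL1 99 100 2 (by norm_num) z (by norm_num; simpa [Y] using hz)
      norm_num at this
      exact this
    · change (trimmed shift coshift true z).1⁻¹ ∈ Set.Ioo (2 : ℝ) 3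
      have := coshift_syllProd_mem _ hL2 98 99 1 (by norm_num) z (by norm_num; simpa [Y] using hz)
      norm_num [-pow_one] at this
      exact this
  · rintro (_ | _ | _) _ ⟨z, hz, rfl⟩
    · have hz1 : z.1 ≠ 1 := by simpa using Irr.ne_int z 1
      have hz2 : ¬ 1 < z.1 := hz
      change z.1 - 2 < -1
      have := lt_of_le_of_ne (not_lt.1 hz2) hz1
      linarith
    · change ((trimmed shift coshift false)⁻¹ z).1⁻¹ ∈ Set.Ioo (-201 : ℝ) (-200)
      have := coshift_syllProd_inv_mem _ hL1 99 100 2 (by norm_num) z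
        (by norm_num; simpa [X] using hz)
      rw [show Set.Ioo (-2 * ((100 : ℕ) : ℝ) - 1) (-2 * (100 : ℕ)) = Set.Ioo (-201) (-200) by
        norm_num] at this
      rw [trimmed]
      convert this using 4
    · change ((trimmed shift coshift true)⁻¹ z).1⁻¹ ∈ Set.Ioo (-199 : ℝ) (-198)
      have := coshift_syllProd_inv_mem _ hL2 98 99 1 (by norm_num) z
        (by norm_num; simpa [X] using hz)
      rw [show Set.Ioo (-2 * ((99 : ℕ) : ℝ) - 1) (-2 * (99 : ℕ)) = Set.Ioo (-199) (-198) by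
        norm_num] at this
      rw [trimmed]
      convert this using 4

end PingPong

/-- In a free group on `g, h`, the elements `g`, `g h² g³ ⋯ h¹⁰⁰` and `h g² h³ ⋯ g¹⁰⁰` are
a basis of a free subgroup. -/
theorem injective_lift_altProd :
    Function.Injective (FreeGroup.lift fun o : Option Bool =>
      o.elim (FreeGroup.of false)
        fun b => altProd (FreeGroup.of b) (FreeGroup.of (!b))) := by
  have h1 : Function.Injective (FreeGroup.lift fun o : Option Bool =>
      o.elim (FreeGroup.of false)
        (PingPong.trimmed (FreeGroup.of false) (FreeGroup.of true))) := by
    have h := PingPong.injective_lift_shift_trimmed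
    refine Function.Injective.of_comp
      (f := FreeGroup.lift fun b : Bool => bif b then PingPong.coshift else PingPong.shift) ?_
    rw [← MonoidHom.coe_comp]
    convert h using 2
    ext1 o
    rcases o with _ | b <;> simp [PingPong.map_trimmed]
  let θ : FreeGroup (Option Bool) →* FreeGroup (Option Bool) := FreeGroup.lift fun o =>
    o.elim (FreeGroup.of none) fun b => bif b then
      FreeGroup.of (some true) * FreeGroup.of none ^ 100
      else FreeGroup.of none * FreeGroup.of (some false)
  let θ' : FreeGroup (Option Bool) →* FreeGroup (Option Bool) := FreeGroup.lift fun o =>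
    o.elim (FreeGroup.of none) fun b => bif b then
      FreeGroup.of (some true) * (FreeGroup.of none ^ 100)⁻¹
      else (FreeGroup.of none)⁻¹ * FreeGroup.of (some false)
  have h2 : Function.Injective θ := by
    have h : θ'.comp θ = MonoidHom.id _ := by
      ext1 o
      rcases o with _ | _ | _ <;> simp [θ, θ']
    exact Function.LeftInverse.injective (g := θ') fun x => DFunLike.congr_fun h x
  have h3 := h1.comp h2
  rw [← MonoidHom.coe_comp] at h3
  convert h3 using 2
  ext1 o
  rcases o with _ | _ | _ <;>
    simp [θ, PingPong.altProd_eq_mul_trimmed (FreeGroup.of false),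
      PingPong.altProd_eq_trimmed_mul (FreeGroup.of false)]

open Monoid in
/-- The image of a word of a free product under a family of homomorphisms which do not kill
any syllable of the word. -/
def Monoid.CoprodI.Word.mapOfNeOne {ι : Type*} {G G' : ι → Type*} [∀ i, Group (G i)]
    [∀ i, Group (G' i)] (θ : ∀ i, G i →* G' i) (w : CoprodI.Word G)
    (h : ∀ k ∈ w.toList, θ k.1 k.2 ≠ 1) : CoprodI.Word G' where
  toList := w.toList.map fun k => ⟨k.1, θ k.1 k.2⟩
  ne_one := by
    intro l hl
    obtain ⟨k, hk, rfl⟩ := List.mem_map.1 hl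
    exact h k hk
  chain_ne := by
    rw [List.isChain_map]
    exact w.chain_ne

open Monoid in
theorem Monoid.CoprodI.Word.prod_mapOfNeOne {ι : Type*} {G G' : ι → Type*} [∀ i, Group (G i)]
    [∀ i, Group (G' i)] (θ : ∀ i, G i →* G' i) (w : CoprodI.Word G)
    (h : ∀ k ∈ w.toList, θ k.1 k.2 ≠ 1) :
    (w.mapOfNeOne θ h).prod = CoprodI.lift (fun i => CoprodI.of.comp (θ i)) w.prod := by
  simp only [CoprodI.Word.prod, CoprodI.Word.mapOfNeOne, map_list_prod, List.map_map]
  rfl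

open Monoid in
/-- A family of injective homomorphisms induces an injective homomorphism of free products. -/
theorem Monoid.CoprodI.injective_lift_of_comp {ι : Type*} {G G' : ι → Type*} [∀ i, Group (G i)]
    [∀ i, Group (G' i)] (θ : ∀ i, G i →* G' i) (hθ : ∀ i, Function.Injective (θ i)) :
    Function.Injective (CoprodI.lift fun i => (CoprodI.of (i := i)).comp (θ i)) := by
  classical
  rw [injective_iff_map_eq_one]
  intro x hx
  obtain ⟨w, rfl⟩ := CoprodI.Word.equiv.symm.surjective x
  change CoprodI.lift _ w.prod = 1 at hx
  change w.prod = 1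
  rw [← CoprodI.Word.prod_mapOfNeOne θ w fun k hk =>
    (map_ne_one_iff _ (hθ k.1)).2 (w.ne_one k hk), ← CoprodI.Word.prod_empty] at hx
  have hinj : Function.Injective (CoprodI.Word.prod : CoprodI.Word G' → _) :=
    CoprodI.Word.equiv.symm.injective
  have h := congrArg CoprodI.Word.toList (hinj hx)
  have hnil : w.toList = [] := by
    simpa [CoprodI.Word.mapOfNeOne, CoprodI.Word.empty] using h
  simp [CoprodI.Word.prod, hnil]

/-- The family consisting of two types. -/
abbrev PairFam (A B : Type) : Bool → Type
  | false => A
  | true => B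

instance (A B : Type) [Group A] [Group B] : ∀ b, Group (PairFam A B b)
  | false => inferInstanceAs (Group A)
  | true => inferInstanceAs (Group B)

/-- The free product of a group with an infinite cyclic group. -/
abbrev AdjoinFree (M : Type) [Group M] := Monoid.CoprodI (PairFam M (FreeGroup Unit))

namespace AdjoinFree

variable {M : Type} [Group M]

/-- The inclusion of `M` in its free product with an infinite cyclic group. -/
def incl : M →* AdjoinFree M := Monoid.CoprodI.of (M := PairFam M (FreeGroup Unit)) (i := false)

/-- The generator of the infinite cyclic factor. -/
def gen : AdjoinFree M :=
  Monoid.CoprodI.of (M := PairFam M (FreeGroup Unit)) (i := true) (FreeGroup.of ())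

theorem incl_injective : Function.Injective (incl : M → AdjoinFree M) :=
  Monoid.CoprodI.of_injective (M := PairFam M (FreeGroup Unit)) false

theorem injective_lift {Z : Type} (a : Z → M) (ha : Function.Injective (FreeGroup.lift a)) :
    Function.Injective (FreeGroup.lift fun o : Option Z => o.elim gen fun z => incl (a z)) := by
  let θ : ∀ b, PairFam (FreeGroup Z) (FreeGroup Unit) b →* PairFam M (FreeGroup Unit) b
    | false => FreeGroup.lift a
    | true => MonoidHom.id _
  have hθ : ∀ b, Function.Injective (θ b)
    | false => ha
    | true => fun _ _ h => h
  have h1 := Monoid.CoprodI.injective_lift_of_comp θ hθ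
  let j : FreeGroup (Option Z) →* AdjoinFree (FreeGroup Z) :=
    FreeGroup.lift fun o => o.elim gen fun z => incl (FreeGroup.of z)
  let r : ∀ b, PairFam (FreeGroup Z) (FreeGroup Unit) b →* FreeGroup (Option Z)
    | false => FreeGroup.map some
    | true => FreeGroup.map fun _ => none
  have h2 : (Monoid.CoprodI.lift r).comp j = MonoidHom.id _ := by
    ext1 o
    rcases o with _ | z
    · simp [j, gen, r]
    · simp [j, incl, r]
  have h3 : Function.Injective j :=
    Function.LeftInverse.injective (g := Monoid.CoprodI.lift r) fun x => DFunLike.congr_fun h2 x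
  have h4 := h1.comp h3
  rw [← MonoidHom.coe_comp] at h4
  convert h4 using 2
  ext1 o
  rcases o with _ | z
  · simp [j, gen, θ]
  · simp [j, incl, θ]

end AdjoinFree

/-- The product `x y x² y ⋯ x¹⁰⁰ y`. -/
@[irreducible] def uProd {M : Type*} [Monoid M] (x y : M) : M :=
  ((List.range 100).map fun k => x ^ (k + 1) * y).prod

theorem map_uProd {M N : Type*} [Monoid M] [Monoid N] (f : M →* N) (x y : M) :
    f (uProd x y) = uProd (f x) (f y) := by
  simp [uProd, map_list_prod, List.map_map, Function.comp_def]

/-- The action of `M × M` on `M × Bool` whose two coordinates act on the two copies of `M`. -/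
def pairAction (M : Type*) [Group M] : M × M →* Equiv.Perm (M × Bool) where
  toFun p :=
    { toFun := fun m => ((bif m.2 then p.2 else p.1) * m.1, m.2)
      invFun := fun m => ((bif m.2 then p.2 else p.1)⁻¹ * m.1, m.2)
      left_inv := fun m => by simp
      right_inv := fun m => by simp }
  map_one' := by ext m <;> rcases m with ⟨m, _ | _⟩ <;> simp
  map_mul' p q := by ext m <;> rcases m with ⟨m, _ | _⟩ <;> simp [mul_assoc]

/-- The involution of `M × Bool` interchanging the two copies of `M`. -/
def flipPerm (M : Type*) : Equiv.Perm (M × Bool) where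
  toFun m := (m.1, !m.2)
  invFun m := (m.1, !m.2)
  left_inv m := by simp
  right_inv m := by simp

theorem pairAction_fst_eq_one {M : Type*} [Group M] (p : M × M) (h : pairAction M p = 1) :
    p.1 = 1 := by
  have := congrArg (fun σ : Equiv.Perm (M × Bool) => (σ (1, false)).1) h
  simpa [pairAction] using this

theorem flipPerm_mul_self (M : Type*) : flipPerm M * flipPerm M = 1 := by
  ext m <;> simp [flipPerm]

theorem flipPerm_mul_pairAction {M : Type*} [Group M] (p : M × M) :
    flipPerm M * pairAction M p = pairAction M p.swap * flipPerm M := by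
  ext m <;> rcases m with ⟨m, _ | _⟩ <;> simp [flipPerm, pairAction]

theorem flipPerm_pow (M : Type*) (n : ℕ) :
    flipPerm M ^ n = if n % 2 = 0 then 1 else flipPerm M := by
  induction n with
  | zero => simp
  | succ n ih =>
    rw [pow_succ, ih]
    rcases Nat.mod_two_eq_zero_or_one n with h | h
    · simp [h, Nat.add_mod]
    · simp [h, Nat.add_mod, flipPerm_mul_self]

theorem uProd_pairAction {M : Type*} [Group M] (g h : M) :
    uProd (pairAction M (g, h)) (flipPerm M) = pairAction M (altProd g h, altProd h g) := by
  have key : ∀ n : ℕ,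
      ((List.range n).map fun k => pairAction M (g, h) ^ (k + 1) * flipPerm M).prod =
        pairAction M (((List.range n).map fun k => (if k % 2 = 0 then g else h) ^ (k + 1)).prod,
          ((List.range n).map fun k => (if k % 2 = 0 then h else g) ^ (k + 1)).prod) *
          flipPerm M ^ n := by
    intro n
    induction n with
    | zero =>
      simp only [List.range_zero, List.map_nil, List.prod_nil, pow_zero, mul_one]
      exact (map_one (pairAction M)).symm
    | succ n ih =>
      rw [List.range_succ]
      simp only [List.map_append, List.prod_append, List.map_cons, List.map_nil, List.prod_cons,
        List.prod_nil, mul_one]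
      have hk : flipPerm M ^ n * pairAction M (g, h) ^ (n + 1) =
          pairAction M ((if n % 2 = 0 then g else h) ^ (n + 1),
            (if n % 2 = 0 then h else g) ^ (n + 1)) * flipPerm M ^ n := by
        rw [flipPerm_pow, ← map_pow]
        split_ifs
        · simp
        · rw [flipPerm_mul_pairAction]
          rfl
      rw [ih, ← Prod.mk_mul_mk, map_mul, mul_assoc, ← mul_assoc (flipPerm M ^ n), hk,
        pow_succ (flipPerm M)]
      simp only [mul_assoc]
  have h100 : flipPerm M ^ 100 = 1 := by rw [flipPerm_pow]; rfl
  rw [uProd, key, h100, mul_one]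
  simp only [altProd]

/-- The relator expressing that `u(x, y) = z`, where `y` is the generator `none`. -/
@[irreducible] def factorRel {X : Type*} (x z : X) : FreeGroup (Option X) :=
  uProd (FreeGroup.of (some x)) (FreeGroup.of none) * (FreeGroup.of (some z))⁻¹

/-- The relators of the factor of a partial map `f`. -/
def factorRels {X : Type*} (f : X → Option X) : Set (FreeGroup (Option X)) :=
  {r | ∃ x z, f x = some z ∧ r = factorRel x z}

/-- The group generated by the elements of `X` and a letter `y`, subject to the relations
`u(x, y) = f x` for all `x` at which the partial map `f` is defined. -/
abbrev Factor {X : Type*} (f : X → Option X) := PresentedGroup (factorRels f)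

namespace Factor

variable {X : Type*} (f : X → Option X)

/-- The homomorphism from the free group on `X` to the factor of a partial map. -/
def base : FreeGroup X →* Factor f := FreeGroup.lift fun x => PresentedGroup.of (some x)

variable {f}

theorem uProd_of {x x' : X} (h : f x = some x') :
    uProd (PresentedGroup.of (rels := factorRels f) (some x)) (PresentedGroup.of none) =
      PresentedGroup.of (some x') := by
  have := PresentedGroup.one_of_mem (rels := factorRels f) (x := factorRel x x') ⟨x, x', h, rfl⟩
  rw [factorRel, map_mul, map_inv, map_uProd, mul_inv_eq_one] at this
  exact this

/-- The universal property of the factor of a partial map. -/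
def lift {M : Type*} [Group M] (φ : X → M) (y : M)
    (h : ∀ x x', f x = some x' → uProd (φ x) y = φ x') : Factor f →* M :=
  PresentedGroup.toGroup (f := fun o : Option X => o.elim y φ) (by
    rintro _ ⟨x, x', hx, rfl⟩
    simp only [factorRel, map_mul, map_inv, map_uProd, FreeGroup.lift_apply_of, Option.elim_some,
      Option.elim_none]
    rw [h x x' hx, mul_inv_cancel])

@[simp]
theorem lift_some {M : Type*} [Group M] (φ : X → M) (y : M)
    (h : ∀ x x', f x = some x' → uProd (φ x) y = φ x') (x : X) :
    lift φ y h (PresentedGroup.of (some x)) = φ x := by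
  simp [lift]

@[simp]
theorem lift_none {M : Type*} [Group M] (φ : X → M) (y : M)
    (h : ∀ x x', f x = some x' → uProd (φ x) y = φ x') :
    lift φ y h (PresentedGroup.of none) = y := by
  simp [lift]

end Factor

theorem exists_finset_mem_normalClosure {X : Type*} (f : X → Option X) (w : FreeGroup (Option X))
    (hw : w ∈ Subgroup.normalClosure (factorRels f)) :
    ∃ S : Finset X, w ∈ Subgroup.normalClosure
      {r | ∃ x ∈ S, ∃ x', f x = some x' ∧ r = factorRel x x'} := by
  classical
  have mono : ∀ {S T : Finset X}, S ⊆ T →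
      Subgroup.normalClosure {r | ∃ x ∈ S, ∃ x', f x = some x' ∧ r = factorRel x x'} ≤
      Subgroup.normalClosure {r | ∃ x ∈ T, ∃ x', f x = some x' ∧ r = factorRel x x'} :=
    fun h => Subgroup.normalClosure_mono fun r ⟨x, hx, y⟩ => ⟨x, h hx, y⟩
  induction hw using Subgroup.closure_induction with
  | mem v hv =>
    obtain ⟨r, ⟨x, x', hx, rfl⟩, hr⟩ := Group.mem_conjugatesOfSet_iff.1 hv
    exact ⟨{x}, Subgroup.conjugatesOfSet_subset_normalClosure
      (Group.mem_conjugatesOfSet_iff.2 ⟨_, ⟨x, by simp, x', hx, rfl⟩, hr⟩)⟩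
  | one => exact ⟨∅, one_mem _⟩
  | mul v w _ _ hv hw =>
    obtain ⟨S, hS⟩ := hv
    obtain ⟨T, hT⟩ := hw
    exact ⟨S ∪ T, mul_mem (mono Finset.subset_union_left hS) (mono Finset.subset_union_right hT)⟩
  | inv v _ hv =>
    obtain ⟨S, hS⟩ := hv
    exact ⟨S, inv_mem hS⟩

/-- A partial map `f` which strictly increases an integer-valued function can be solved on a
finite set by pairs of elements of a group. -/
theorem exists_pairs {X : Type} (f : X → Option X) (l : X → ℤ)
    (hl : ∀ x x', f x = some x' → l x < l x') (S : Finset X) :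
    ∃ (M : Type) (_ : Group M) (n : X → Bool → M),
      Function.Injective (FreeGroup.lift fun x => n x false) ∧
      (∀ x, Function.Injective (FreeGroup.lift (n x))) ∧
      ∀ x ∈ S, ∀ x', f x = some x' → ∀ b, altProd (n x b) (n x (!b)) = n x' b := by
  classical
  induction S using Finset.induction_on_min_value l with
  | empty =>
    refine ⟨FreeGroup (X × Bool), inferInstance, fun x b => FreeGroup.of (x, b), ?_, ?_, by simp⟩
    · have : Function.Injective fun x : X => (x, false) := fun x y h => congrArg Prod.fst h
      convert FreeGroup.map_injective this using 2
      ext1 x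
      simp
    · intro x
      have : Function.Injective fun b : Bool => (x, b) := fun x y h => congrArg Prod.snd h
      convert FreeGroup.map_injective this using 2
      ext1 x
      simp
  | insert c S hcS hmin ih =>
    obtain ⟨M, _, n, h1, h2, h3⟩ := ih
    rcases hc : f c with _ | x₀
    · refine ⟨M, inferInstance, n, h1, h2, fun x hx x' hx' => ?_⟩
      rcases Finset.mem_insert.1 hx with rfl | hx
      · rw [hc] at hx'; cases hx'
      · exact h3 x hx x' hx'
    have hx₀ : x₀ ≠ c := by
      rintro rfl
      exact lt_irrefl _ (hl _ _ hc)
    let F := PairFam (AdjoinFree M) (FreeGroup Bool)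
    let φ : ∀ b, FreeGroup (Option Bool) →* F b
      | false => FreeGroup.lift fun o => o.elim AdjoinFree.gen fun b => AdjoinFree.incl (n x₀ b)
      | true => FreeGroup.lift fun o => o.elim (FreeGroup.of false)
          fun b => altProd (FreeGroup.of b) (FreeGroup.of (!b))
    have hφ : ∀ b, Function.Injective (φ b)
      | false => AdjoinFree.injective_lift _ (h2 x₀)
      | true => injective_lift_altProd
    let i₁ : AdjoinFree M →* Monoid.PushoutI φ := Monoid.PushoutI.of (φ := φ) false
    let i₂ : FreeGroup Bool →* Monoid.PushoutI φ := Monoid.PushoutI.of (φ := φ) true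
    have hi₁ : Function.Injective i₁ := Monoid.PushoutI.of_injective hφ false
    have hi₂ : Function.Injective i₂ := Monoid.PushoutI.of_injective hφ true
    have hglue : ∀ z, i₁ (φ false z) = i₂ (φ true z) := fun z =>
      (Monoid.PushoutI.of_apply_eq_base φ false z).trans
        (Monoid.PushoutI.of_apply_eq_base φ true z).symm
    have hgen : i₁ AdjoinFree.gen = i₂ (FreeGroup.of false) := by
      simpa [φ] using hglue (FreeGroup.of none)
    have halt : ∀ b, i₁ (AdjoinFree.incl (n x₀ b)) =
        i₂ (altProd (FreeGroup.of b) (FreeGroup.of (!b))) := fun b => by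
      simpa [φ] using hglue (FreeGroup.of (some b))
    refine ⟨Monoid.PushoutI φ, inferInstance, fun x b => if x = c then i₂ (FreeGroup.of b)
      else i₁ (AdjoinFree.incl (n x b)), ?_, ?_, ?_⟩
    · have h4 : Function.Injective (FreeGroup.lift fun x : {x // x ≠ c} => n x false) := by
        have := h1.comp (FreeGroup.map_injective (Subtype.val_injective (p := fun x => x ≠ c)))
        rw [← MonoidHom.coe_comp] at this
        convert this using 2
        ext1 x
        simp
      have h5 := hi₁.comp ((AdjoinFree.injective_lift _ h4).comp
        (FreeGroup.map_injective (Equiv.optionSubtypeNe c).symm.injective))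
      rw [← MonoidHom.coe_comp, ← MonoidHom.coe_comp] at h5
      convert h5 using 2
      ext1 x
      by_cases hx : x = c
      · subst hx
        simp [hgen]
      · simp [hx]
    · intro x
      by_cases hx : x = c
      · simp only [hx, if_true]
        convert hi₂ using 2
        ext1 b
        simp
      · simp only [hx, if_false]
        have := hi₁.comp (AdjoinFree.incl_injective.comp (h2 x))
        rw [← MonoidHom.coe_comp, ← MonoidHom.coe_comp] at this
        convert this using 2
        ext1 b
        simp
    · intro x hx x' hx' b
      rcases Finset.mem_insert.1 hx with rfl | hxS
      · obtain rfl : x₀ = x' := by rw [hc] at hx'; exact Option.some.inj hx'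
        simp only [if_true, if_neg hx₀]
        rw [halt, map_altProd]
      · have hxc : x ≠ c := fun h => hcS (h ▸ hxS)
        have hx'c : x' ≠ c := by
          rintro rfl
          exact absurd (hl _ _ hx') (not_lt.2 (hmin x hxS))
        simp only [if_neg hxc, if_neg hx'c]
        rw [← h3 x hxS x' hx' b, map_altProd, map_altProd]

/-- If the partial map `f` strictly increases an integer-valued function, then the free group on
`X` embeds in the factor of `f`. -/
theorem Factor.base_injective {X : Type} (f : X → Option X) (l : X → ℤ)
    (hl : ∀ x x', f x = some x' → l x < l x') : Function.Injective (Factor.base f) := by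
  rw [injective_iff_map_eq_one]
  intro w hw
  have hw' : FreeGroup.map some w ∈ Subgroup.normalClosure (factorRels f) := by
    rw [← PresentedGroup.mk_eq_one_iff, ← hw]
    rw [← MonoidHom.comp_apply]
    congr 1
    ext1 x
    simp [Factor.base, PresentedGroup.of]
  obtain ⟨S, hS⟩ := exists_finset_mem_normalClosure f _ hw'
  obtain ⟨M, _, n, h1, -, h3⟩ := exists_pairs f l hl S
  let ψ : FreeGroup (Option X) →* Equiv.Perm (M × Bool) := FreeGroup.lift fun o =>
    o.elim (flipPerm M) fun x => pairAction M (n x false, n x true)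
  have hψ : Subgroup.normalClosure {r | ∃ x ∈ S, ∃ x', f x = some x' ∧ r = factorRel x x'} ≤
      ψ.ker := by
    refine Subgroup.normalClosure_le_normal ?_
    rintro _ ⟨x, hx, x', hx', rfl⟩
    change ψ (factorRel x x') = 1
    rw [factorRel, map_mul, map_inv, map_uProd, mul_inv_eq_one]
    simp only [ψ, FreeGroup.lift_apply_of, Option.elim_some, Option.elim_none]
    rw [uProd_pairAction, ← h3 x hx x' hx' false, ← h3 x hx x' hx' true]
    rfl
  have h4 : ψ (FreeGroup.map some w) = 1 := hψ hS
  have h5 : ψ.comp (FreeGroup.map some) = (pairAction M).comp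
      ((FreeGroup.lift fun x => n x false).prod (FreeGroup.lift fun x => n x true)) := by
    ext1 x
    simp [ψ]
  rw [← MonoidHom.comp_apply, h5] at h4
  refine (injective_iff_map_eq_one _).1 h1 w ?_
  exact pairAction_fst_eq_one _ h4

open Monoid PushoutI in
/-- Every element of an amalgamated product is the product of an element of the base and a
reduced word. -/
theorem Monoid.PushoutI.exists_reduced {ι : Type*} {G : ι → Type*} [∀ i, Group (G i)] {H : Type*}
    [Group H] {φ : ∀ i, H →* G i} (hφ : ∀ i, Function.Injective (φ i)) (x : PushoutI φ) :
    ∃ (h : H) (w : CoprodI.Word G), Reduced φ w ∧ x = base φ h * ofCoprodI w.prod := by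
  classical
  obtain ⟨d⟩ := NormalWord.transversal_nonempty φ hφ
  refine ⟨(NormalWord.equiv (d := d) x).head, (NormalWord.equiv (d := d) x).toWord, ?_,
    ((NormalWord.equiv (d := d)).symm_apply_apply x).symm⟩
  rintro ⟨i, g⟩ hg hgr
  have hgs := (NormalWord.equiv (d := d) x).normalized i g hg
  have h := @(d.compl i).1 (⟨g, hgr⟩, ⟨1, d.one_mem i⟩) (⟨1, one_mem _⟩, ⟨g, hgs⟩) (by simp)
  exact (NormalWord.equiv (d := d) x).ne_one _ hg
    (congrArg (fun p : (φ i).range × d.set i => (p.1 : G i)) h)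

open Monoid PushoutI in
/-- A homomorphism of amalgamated products does not kill a product of a base element with a
reduced word if it maps every syllable outside the base group. -/
theorem Monoid.PushoutI.map_ne_one {ι : Type*} {G G' : ι → Type*} [∀ i, Group (G i)]
    [∀ i, Group (G' i)] {H H' : Type*} [Group H] [Group H'] {φ : ∀ i, H →* G i}
    {φ' : ∀ i, H' →* G' i} (hφ' : ∀ i, Function.Injective (φ' i)) (β : H →* H')
    (θ : ∀ i, G i →* G' i) (F : PushoutI φ →* PushoutI φ')
    (hF : ∀ i k, F (of i k) = of i (θ i k)) (hFb : ∀ h, F (base φ h) = base φ' (β h))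
    (h : H) (w : CoprodI.Word G) (hw : ∀ k ∈ w.toList, θ k.1 k.2 ∉ (φ' k.1).range)
    (hh : w.toList = [] → β h ≠ 1) : F (base φ h * ofCoprodI w.prod) ≠ 1 := by
  intro h1
  have hne : ∀ k ∈ w.toList, θ k.1 k.2 ≠ 1 := fun k hk h0 => hw k hk (h0 ▸ one_mem _)
  have hcomp : F.comp (ofCoprodI (φ := φ)) =
      (ofCoprodI (φ := φ')).comp (CoprodI.lift fun i => CoprodI.of.comp (θ i)) := by
    ext i k
    simp [hF]
  have hprod : F (ofCoprodI w.prod) = ofCoprodI (φ := φ') (w.mapOfNeOne θ hne).prod := by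
    rw [CoprodI.Word.prod_mapOfNeOne, ← MonoidHom.comp_apply, hcomp]
    rfl
  rw [map_mul, hFb, hprod] at h1
  have hred : Reduced φ' (w.mapOfNeOne θ hne) := by
    intro k' hk'
    obtain ⟨k, hk, rfl⟩ := List.mem_map.1 hk'
    exact hw k hk
  have hempty := hred.eq_empty_of_mem_range hφ'
    ⟨(β h)⁻¹, by rw [map_inv]; exact inv_eq_of_mul_eq_one_right h1⟩
  rw [hempty, CoprodI.Word.prod_empty, map_one, mul_one] at h1
  refine hh ?_ (base_injective hφ' (h1.trans (map_one _).symm))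
  simpa [CoprodI.Word.mapOfNeOne, CoprodI.Word.empty] using congrArg CoprodI.Word.toList hempty

namespace Factor

variable {X : Type*} {f : X → Option X}

@[simp]
theorem base_of (x : X) : base f (FreeGroup.of x) = PresentedGroup.of (some x) := by
  simp [base]

/-- The endomorphism of the factor of `f` induced by a self-map compatible with `f`. -/
def map (s : X → X) (hs : ∀ x x', f x = some x' → f (s x) = some (s x')) : Factor f →* Factor f :=
  lift (fun x => PresentedGroup.of (some (s x))) (PresentedGroup.of none)
    fun x x' h => uProd_of (hs x x' h)

theorem map_base (s : X → X) (hs : ∀ x x', f x = some x' → f (s x) = some (s x'))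
    (w : FreeGroup X) : map s hs (base f w) = base f (FreeGroup.map s w) := by
  have : (map s hs).comp (base f) = (base f).comp (FreeGroup.map s) := by
    ext1 x
    simp [map]
  exact DFunLike.congr_fun this w

variable {I : Type*} {F : Filter I} (ρ s : I → X → X)
  (hρ : ∀ i x x', f x = some x' → f (ρ i x) = some (ρ i x'))

theorem eventually_map_map_eq
    (hs : ∀ i x x', f x = some x' → f (s i x) = some (s i x'))
    (hsρ : ∀ x, ∀ᶠ i in F, s i (ρ i x) = x) (k : Factor f) :
    ∀ᶠ i in F, map (s i) (hs i) (map (ρ i) (hρ i) k) = k := by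
  have hk : k ∈ Subgroup.closure (Set.range (PresentedGroup.of (rels := factorRels f))) := by
    rw [PresentedGroup.closure_range_of]
    trivial
  induction hk using Subgroup.closure_induction with
  | mem k hk =>
    obtain ⟨_ | x, rfl⟩ := hk
    · simp [map]
    · filter_upwards [hsρ x] with i hi
      simp [map, hi]
  | one => simp
  | mul v w _ _ hv hw =>
    filter_upwards [hv, hw] with i hi hi'
    simp [hi, hi']
  | inv v _ hv =>
    filter_upwards [hv] with i hi
    simp [hi]

theorem eventually_map_notMem_range
    (hs : ∀ i x x', f x = some x' → f (s i x) = some (s i x'))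
    (hsρ : ∀ x, ∀ᶠ i in F, s i (ρ i x) = x) (k : Factor f)
    (hk : k ∉ (base f).range) : ∀ᶠ i in F, map (ρ i) (hρ i) k ∉ (base f).range := by
  filter_upwards [eventually_map_map_eq ρ s hρ hs hsρ k] with i hi
  rintro ⟨v, hv⟩
  rw [← hv, map_base] at hi
  exact hk ⟨_, hi⟩

end Factor

/-- The amalgamated product of the factors of a family of partial maps, over the free group
on their common domain. -/
abbrev Amalgam {X ι : Type*} (f : ι → X → Option X) :=
  Monoid.PushoutI fun y => Factor.base (f y)

namespace Amalgam

variable {X ι : Type*} {f : ι → X → Option X}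

/-- The endomorphism of the amalgam induced by a self-map compatible with all the partial maps. -/
def map (ρ : X → X) (hρ : ∀ y x x', f y x = some x' → f y (ρ x) = some (ρ x')) :
    Amalgam f →* Amalgam f :=
  Monoid.PushoutI.lift (fun y => (Monoid.PushoutI.of y).comp (Factor.map ρ (hρ y)))
    ((Monoid.PushoutI.base _).comp (FreeGroup.map ρ)) fun y => by
      ext1 x
      simp only [MonoidHom.comp_apply, Factor.map_base]
      rw [Monoid.PushoutI.of_apply_eq_base fun y => Factor.base (f y)]

theorem map_of (ρ : X → X) (hρ : ∀ y x x', f y x = some x' → f y (ρ x) = some (ρ x')) (y : ι)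
    (k : Factor (f y)) :
    map ρ hρ (Monoid.PushoutI.of y k) = Monoid.PushoutI.of y (Factor.map ρ (hρ y) k) := by
  simp [map]

theorem map_base (ρ : X → X) (hρ : ∀ y x x', f y x = some x' → f y (ρ x) = some (ρ x'))
    (w : FreeGroup X) :
    map ρ hρ (Monoid.PushoutI.base _ w) = Monoid.PushoutI.base _ (FreeGroup.map ρ w) := by
  simp [map]

theorem eventually_map_ne_one [Nonempty ι] (hf : ∀ y, Function.Injective (Factor.base (f y)))
    {I : Type*} {F : Filter I} (ρ : I → X → X) (s : ι → I → X → X)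
    (hρ : ∀ i y x x', f y x = some x' → f y (ρ i x) = some (ρ i x'))
    (hs : ∀ y i x x', f y x = some x' → f y (s y i x) = some (s y i x'))
    (hsρ : ∀ y x, ∀ᶠ i in F, s y i (ρ i x) = x) (d : Amalgam f) (hd : d ≠ 1) :
    ∀ᶠ i in F, map (ρ i) (hρ i) d ≠ 1 := by
  obtain ⟨h, w, hw, rfl⟩ := Monoid.PushoutI.exists_reduced hf d
  have h1 : ∀ᶠ i in F, ∀ k ∈ w.toList,
      Factor.map (ρ i) (hρ i k.1) k.2 ∉ (Factor.base (f k.1)).range :=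
    (List.finite_toSet w.toList).eventually_all.2 fun k hk =>
      Factor.eventually_map_notMem_range ρ (s k.1) (fun i => hρ i k.1) (hs k.1) (hsρ k.1) k.2
        (hw k hk)
  have h2 : w.toList = [] → ∀ᶠ i in F, FreeGroup.map (ρ i) h ≠ 1 := by
    intro hnil
    obtain ⟨y⟩ := ‹Nonempty ι›
    filter_upwards [Factor.eventually_map_map_eq ρ (s y) (fun i => hρ i y) (hs y) (hsρ y)
      (Factor.base (f y) h)] with i hi h0
    rw [Factor.map_base, h0, map_one, map_one] at hi
    apply hd
    rw [(hf y) (hi.symm.trans (map_one _).symm)]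
    simp [Monoid.CoprodI.Word.prod, hnil]
  have h2' : ∀ᶠ i in F, w.toList = [] → FreeGroup.map (ρ i) h ≠ 1 := by
    by_cases hnil : w.toList = []
    · filter_upwards [h2 hnil] with i hi _ using hi
    · simp [hnil]
  filter_upwards [h1, h2'] with i hi hi'
  exact Monoid.PushoutI.map_ne_one hf (FreeGroup.map (ρ i)) (fun y => Factor.map (ρ i) (hρ i y))
    _ (fun y k => map_of _ _ y k) (fun h => map_base _ _ h) h w hi hi'

/-- The element of the amalgam given by an element of the common domain. -/
def vert (f : ι → X → Option X) (x : X) : Amalgam f := Monoid.PushoutI.base _ (FreeGroup.of x)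

/-- The letter of a factor of the amalgam. -/
def letter (f : ι → X → Option X) (y : ι) : Amalgam f :=
  Monoid.PushoutI.of y (PresentedGroup.of none)

theorem of_some (y : ι) (x : X) :
    (Monoid.PushoutI.of y (PresentedGroup.of (some x)) : Amalgam f) = vert f x := by
  rw [vert, ← Monoid.PushoutI.of_apply_eq_base _ y, Factor.base_of]

theorem uProd_vert {y : ι} {x x' : X} (h : f y x = some x') :
    uProd (vert f x) (letter f y) = vert f x' := by
  rw [← of_some y, ← of_some y, letter, ← map_uProd, Factor.uProd_of h]

/-- The universal property of the amalgam. -/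
def lift {M : Type*} [Group M] (φ : X → M) (c : ι → M)
    (h : ∀ y x x', f y x = some x' → uProd (φ x) (c y) = φ x') : Amalgam f →* M :=
  Monoid.PushoutI.lift (fun y => Factor.lift φ (c y) (h y)) (FreeGroup.lift φ) fun y => by
    ext1 x
    simp

@[simp]
theorem lift_vert {M : Type*} [Group M] (φ : X → M) (c : ι → M)
    (h : ∀ y x x', f y x = some x' → uProd (φ x) (c y) = φ x') (x : X) :
    lift φ c h (vert f x) = φ x := by
  simp [lift, vert]

@[simp]
theorem lift_letter {M : Type*} [Group M] (φ : X → M) (c : ι → M)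
    (h : ∀ y x x', f y x = some x' → uProd (φ x) (c y) = φ x') (y : ι) :
    lift φ c h (letter f y) = c y := by
  simp [lift, letter]

@[simp]
theorem map_vert (ρ : X → X) (hρ : ∀ y x x', f y x = some x' → f y (ρ x) = some (ρ x')) (x : X) :
    map ρ hρ (vert f x) = vert f (ρ x) := by
  simp [vert, map_base]

@[simp]
theorem map_letter (ρ : X → X) (hρ : ∀ y x x', f y x = some x' → f y (ρ x) = some (ρ x'))
    (y : ι) : map ρ hρ (letter f y) = letter f y := by
  rw [letter, map_of]
  simp [Factor.map]

theorem hom_ext {M : Type*} [Group M] {φ ψ : Amalgam f →* M}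
    (hv : ∀ x, φ (vert f x) = ψ (vert f x)) (hl : ∀ y, φ (letter f y) = ψ (letter f y)) :
    φ = ψ := by
  refine Monoid.PushoutI.hom_ext (fun y => ?_) ?_
  · refine PresentedGroup.ext fun o => ?_
    rcases o with _ | x
    · exact hl y
    · simpa [of_some] using hv x
  · ext1 x
    exact hv x

end Amalgam

theorem prod_uWord {α : Type} {M : Type*} [Group M] (φ : α → M) (x y : α) :
    ((uWord x y).map fun p => cond p.2 (φ p.1) (φ p.1)⁻¹).prod = uProd (φ x) (φ y) := by
  simp [uWord, uProd, List.flatMap_def, List.map_flatten, List.prod_flatten, List.map_map,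
    Function.comp_def]

theorem lift_GRels {M : Type*} [Group M] (φ : GGen → M)
    (ha : ∀ n τ, uProd (φ (some (KGen.vert n τ))) (φ (some KGen.a)) =
      φ (some (KGen.vert (parent n τ).1 (parent n τ).2)))
    (hb : ∀ n τ i, uProd (φ (some (KGen.vert n τ))) (φ (some (KGen.b i))) =
      φ (some (KGen.vert n (τ ++ [i]))))
    (ht : ∀ i, φ none * φ (some (KGen.b i)) * (φ none)⁻¹ = φ (some (KGen.b (i + 1)))) :
    ∀ r ∈ GRels, FreeGroup.lift φ r = 1 := by
  rintro _ ⟨_, ⟨w, ⟨n, τ, rfl⟩ | ⟨n, τ, i, rfl⟩, rfl⟩ | ⟨i, rfl⟩, rfl⟩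
  · have := prod_uWord (fun k => φ (some k)) (KGen.vert n τ) KGen.a
    simp only [FreeGroup.lift_mk, List.map_append, List.prod_append, List.map_map,
      Function.comp_def, this, ha]
    simp
  · have := prod_uWord (fun k => φ (some k)) (KGen.vert n τ) (KGen.b i)
    simp only [FreeGroup.lift_mk, List.map_append, List.prod_append, List.map_map,
      Function.comp_def, this, hb]
    simp
  · simp [FreeGroup.lift_mk, ← mul_assoc, ht]

theorem prod_of_GRelWords (w : Word GGen) (hw : w ∈ GRelWords) :
    (w.map fun p => cond p.2 (PresentedGroup.of (rels := GRels) p.1)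
      (PresentedGroup.of (rels := GRels) p.1)⁻¹).prod = 1 := by
  have h := PresentedGroup.one_of_mem (rels := GRels) ⟨w, hw, rfl⟩
  have h' : PresentedGroup.mk GRels = FreeGroup.lift (PresentedGroup.of (rels := GRels)) := by
    ext1 x
    simp [PresentedGroup.of]
  rwa [h', FreeGroup.lift_mk] at h

theorem uProd_gvert_ga (n : ℕ) (τ : List ℤ) :
    uProd (gvert n τ) ga = gvert (parent n τ).1 (parent n τ).2 := by
  have h := prod_of_GRelWords _ (Or.inl ⟨_, Or.inl ⟨n, τ, rfl⟩, rfl⟩)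
  have hu := prod_uWord (fun k => PresentedGroup.of (rels := GRels) (some k)) (KGen.vert n τ)
    KGen.a
  simp only [List.map_append, List.prod_append, List.map_map, Function.comp_def, hu] at h
  simpa [gvert, ga, mul_inv_eq_one] using h

theorem uProd_gvert_gb (n : ℕ) (τ : List ℤ) (i : ℤ) :
    uProd (gvert n τ) (gb i) = gvert n (τ ++ [i]) := by
  have h := prod_of_GRelWords _ (Or.inl ⟨_, Or.inr ⟨n, τ, i, rfl⟩, rfl⟩)
  have hu := prod_uWord (fun k => PresentedGroup.of (rels := GRels) (some k)) (KGen.vert n τ)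
    (KGen.b i)
  simp only [List.map_append, List.prod_append, List.map_map, Function.comp_def, hu] at h
  simpa [gvert, gb, mul_inv_eq_one] using h

theorem gt_mul_gb (i : ℤ) : gt' * gb i * gt'⁻¹ = gb (i + 1) := by
  have h := prod_of_GRelWords _ (Or.inr ⟨i, rfl⟩)
  simpa [gt', gb, ← mul_assoc, mul_inv_eq_one] using h

theorem gt_zpow_mul_gb (k i : ℤ) : gt' ^ k * gb i * (gt' ^ k)⁻¹ = gb (i + k) := by
  induction k with
  | zero => simp
  | succ k ih =>
    rw [← add_assoc, ← gt_mul_gb, ← ih, add_comm (k : ℤ) 1, zpow_add, zpow_one]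
    group
  | pred k ih =>
    rw [show i + -(k : ℤ) = i + (-k - 1) + 1 by ring, ← gt_mul_gb] at ih
    rw [show (-k - 1 : ℤ) = -1 + -k by ring, zpow_add]
    rw [show (-1 + -k : ℤ) = -k - 1 by ring]
    calc _ = gt'⁻¹ * (gt' ^ (-k : ℤ) * gb i * (gt' ^ (-k : ℤ))⁻¹) * gt' := by group
      _ = _ := by rw [ih]; group

@[simp]
theorem conj_gt_zpow_gb (k i : ℤ) : (MulAut.conj gt' ^ k) (gb i) = gb (i + k) := by
  rw [← map_zpow, MulAut.conj_apply, gt_zpow_mul_gb]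

/-- The vertices of countably many disjoint copies of the tree. -/
abbrev Verts := (ℕ × List ℤ) × ℤ

/-- The partial maps on the copies of the tree: `inl c` sends a vertex of the copy `c` to its
parent, and `inr j` appends `j` in every copy. -/
def step : ℤ ⊕ ℤ → Verts → Option Verts
  | .inl c, x => if x.2 = c then some (parent x.1.1 x.1.2, c) else none
  | .inr j, x => some ((x.1.1, x.1.2 ++ [j]), x.2)

theorem parent_map (g : ℤ → ℤ) (n : ℕ) (τ : List ℤ) :
    parent n (τ.map g) = ((parent n τ).1, (parent n τ).2.map g) := by
  cases τ <;> simp [parent, List.map_dropLast]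

theorem step_base_injective (y : ℤ ⊕ ℤ) : Function.Injective (Factor.base (step y)) := by
  rcases y with c | j
  · refine Factor.base_injective _ (fun x => (x.1.1 : ℤ) - x.1.2.length) ?_
    rintro ⟨⟨n, τ⟩, c'⟩ x' h
    simp only [step, Option.ite_none_right_eq_some, Option.some.injEq] at h
    obtain ⟨-, rfl⟩ := h
    cases τ <;> simp [parent]
  · refine Factor.base_injective _ (fun x => x.1.2.length) ?_
    rintro ⟨⟨n, τ⟩, c'⟩ x' h
    simp only [step, Option.some.injEq] at h
    subst h
    simp

/-- The simultaneous shift by `k` of the copies and of the labels of the tree. -/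
def shift (k : ℤ) : Amalgam step →* Amalgam step :=
  Amalgam.lift (fun x => Amalgam.vert step ((x.1.1, x.1.2.map (· + k)), x.2 + k))
    (fun y => Amalgam.letter step (y.map (· + k) (· + k))) (by
      rintro (c | j) ⟨⟨n, τ⟩, c'⟩ x' h
      · simp only [step, Option.ite_none_right_eq_some, Option.some.injEq] at h
        obtain ⟨rfl, rfl⟩ := h
        apply Amalgam.uProd_vert
        simp [step, parent_map]
      · simp only [step, Option.some.injEq] at h
        subst h
        apply Amalgam.uProd_vert
        simp [step])

@[simp]
theorem shift_vert (k : ℤ) (x : Verts) : shift k (Amalgam.vert step x) =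
    Amalgam.vert step ((x.1.1, x.1.2.map (· + k)), x.2 + k) := by
  simp [shift]

@[simp]
theorem shift_letter (k : ℤ) (y : ℤ ⊕ ℤ) : shift k (Amalgam.letter step y) =
    Amalgam.letter step (y.map (· + k) (· + k)) := by
  simp [shift]

theorem shift_zero : shift 0 = MonoidHom.id _ := by
  refine Amalgam.hom_ext (fun x => ?_) fun y => ?_
  · simp
  · rcases y with c | j <;> simp

theorem shift_add (k l : ℤ) : shift (k + l) = (shift k).comp (shift l) := by
  refine Amalgam.hom_ext (fun x => ?_) fun y => ?_
  · simp [Function.comp_def, add_assoc, add_comm l]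
  · rcases y with c | j <;> simp [add_assoc, add_comm l]

/-- The action of `ℤ` on the amalgam by shifts. -/
def shiftAut : Multiplicative ℤ →* MulAut (Amalgam step) where
  toFun k := MonoidHom.toMulEquiv (shift k.toAdd) (shift (-k.toAdd))
    (by rw [← shift_add, neg_add_cancel, shift_zero])
    (by rw [← shift_add, add_neg_cancel, shift_zero])
  map_one' := by
    ext d
    simp [shift_zero]
  map_mul' k l := by
    ext d
    simp [shift_add]

@[simp]
theorem shiftAut_apply (k : Multiplicative ℤ) (d : Amalgam step) :
    shiftAut k d = shift k.toAdd d := rfl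

open SemidirectProduct in
/-- The homomorphism from `G` to the semidirect product of the amalgam with the shifts. -/
def toSemidirect : G →* Amalgam step ⋊[shiftAut] Multiplicative ℤ :=
  PresentedGroup.toGroup (f := fun o : GGen => o.elim (inr (Multiplicative.ofAdd (1 : ℤ))) fun
      | .vert n τ => inl (Amalgam.vert step ((n, τ), 0))
      | .a => inl (Amalgam.letter step (.inl 0))
      | .b j => inl (Amalgam.letter step (.inr j))) (by
    refine lift_GRels _ (fun n τ => ?_) (fun n τ i => ?_) fun i => ?_
    · simp only [Option.elim_some, ← map_uProd]
      rw [Amalgam.uProd_vert]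
      simp [step]
    · simp only [Option.elim_some, ← map_uProd]
      rw [Amalgam.uProd_vert]
      simp [step]
    · simp only [Option.elim_some, Option.elim_none]
      rw [← map_inv, ← inl_aut]
      simp)

section

open SemidirectProduct

@[simp]
theorem toSemidirect_gvert (n : ℕ) (τ : List ℤ) :
    toSemidirect (gvert n τ) = inl (Amalgam.vert step ((n, τ), 0)) := by
  simp [toSemidirect, gvert]

@[simp]
theorem toSemidirect_ga : toSemidirect ga = inl (Amalgam.letter step (.inl 0)) := by
  simp [toSemidirect, ga]

@[simp]
theorem toSemidirect_gb (j : ℤ) : toSemidirect (gb j) = inl (Amalgam.letter step (.inr j)) := by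
  simp [toSemidirect, gb]

@[simp]
theorem toSemidirect_gt : toSemidirect gt' = inr (Multiplicative.ofAdd (1 : ℤ)) := by
  simp [toSemidirect, gt']

end

theorem G_hom_ext {M : Type*} [Group M] {φ ψ : G →* M}
    (hv : ∀ n τ, φ (gvert n τ) = ψ (gvert n τ)) (ha : φ ga = ψ ga)
    (hb : ∀ j, φ (gb j) = ψ (gb j)) (ht : φ gt' = ψ gt') : φ = ψ := by
  refine PresentedGroup.ext fun o => ?_
  rcases o with _ | ⟨n, τ⟩ | _ | j
  exacts [ht, hv n τ, ha, hb j]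

/-- The homomorphism from the amalgam to `G`. -/
def ofAmalgam : Amalgam step →* G :=
  Amalgam.lift (fun x => MulAut.conj (gt' ^ x.2) (gvert x.1.1 (x.1.2.map (· - x.2))))
    (Sum.elim (fun c => MulAut.conj (gt' ^ c) ga) gb) (by
      rintro (c | j) ⟨⟨n, τ⟩, c'⟩ x' h
      · simp only [step, Option.ite_none_right_eq_some, Option.some.injEq] at h
        obtain ⟨rfl, rfl⟩ := h
        have := map_uProd (MulAut.conj (gt' ^ c')).toMonoidHom (gvert n (τ.map (· - c'))) ga
        simp only [Sum.elim_inl]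
        refine this.symm.trans ?_
        rw [uProd_gvert_ga, parent_map]
        rfl
      · simp only [step, Option.some.injEq] at h
        subst h
        have := map_uProd (MulAut.conj (gt' ^ c')).toMonoidHom (gvert n (τ.map (· - c')))
          (gb (j - c'))
        simp only [Sum.elim_inr, List.map_append, List.map_cons, List.map_nil]
        rw [← uProd_gvert_gb]
        refine Eq.trans ?_ this.symm
        simp)

theorem toSemidirect_injective : Function.Injective toSemidirect := by
  have hcomm : ∀ k, ofAmalgam.comp (shiftAut k).toMonoidHom =
      (MulAut.conj (zpowersHom G gt' k)).toMonoidHom.comp ofAmalgam := by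
    intro k
    refine Amalgam.hom_ext (fun x => ?_) fun y => ?_
    · simp [ofAmalgam, Function.comp_def, zpow_add, add_comm _ k.toAdd]
    · rcases y with c | j
      · simp [ofAmalgam, zpow_add, add_comm _ k.toAdd]
      · simp [ofAmalgam]
  have h : (SemidirectProduct.lift ofAmalgam (zpowersHom G gt') hcomm).comp toSemidirect =
      MonoidHom.id G := by
    refine G_hom_ext (fun n τ => ?_) ?_ (fun j => ?_) ?_ <;> simp [ofAmalgam]
  exact Function.LeftInverse.injective (g := SemidirectProduct.lift ofAmalgam _ hcomm)
    (DFunLike.congr_fun h)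

/-- The self-map of the copies of the tree which moves the vertex `(0, τ)` to
`(1, (i + c) :: τ)` in the copy `c`. -/
def push (i : ℤ) (x : Verts) : Verts :=
  if x.1.1 = 0 then ((1, (i + x.2) :: x.1.2), x.2) else x

/-- A partial left inverse of `push i` compatible with the partial map `step y`. -/
def unpush : ℤ ⊕ ℤ → ℤ → Verts → Verts
  | y, i, ((1, k :: τ), c) => if k = i + c ∧ y ≠ .inr (i + c) then ((0, τ), c) else ((1, k :: τ), c)
  | _, _, x => x

theorem step_push (i : ℤ) (y : ℤ ⊕ ℤ) (x x' : Verts) (h : step y x = some x') :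
    step y (push i x) = some (push i x') := by
  obtain ⟨⟨n, τ⟩, c⟩ := x
  rcases y with c' | j
  · simp only [step, Option.ite_none_right_eq_some, Option.some.injEq] at h
    obtain ⟨rfl, rfl⟩ := h
    rcases n with _ | n <;> rcases τ with _ | ⟨k, τ⟩ <;> simp [push, step, parent]
  · simp only [step, Option.some.injEq] at h
    subst h
    rcases n with _ | n <;> simp [push, step]

theorem step_unpush (y : ℤ ⊕ ℤ) (i : ℤ) (x x' : Verts) (h : step y x = some x') :
    step y (unpush y i x) = some (unpush y i x') := by
  obtain ⟨⟨n, τ⟩, c⟩ := x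
  rcases y with c' | j
  · simp only [step, Option.ite_none_right_eq_some, Option.some.injEq] at h
    obtain ⟨rfl, rfl⟩ := h
    rcases n with _ | _ | n <;> rcases τ with _ | ⟨k, _ | ⟨l, τ⟩⟩ <;>
      simp [unpush, step, parent] <;> split_ifs <;> simp
  · simp only [step, Option.some.injEq] at h
    subst h
    rcases n with _ | _ | n <;> rcases τ with _ | ⟨k, τ⟩ <;> simp [unpush, step] <;>
      split_ifs <;> simp_all

theorem eventually_unpush_push (y : ℤ ⊕ ℤ) (x : Verts) :
    ∀ᶠ i in Filter.cofinite, unpush y i (push i x) = x := by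
  obtain ⟨⟨n, τ⟩, c⟩ := x
  rcases n with _ | _ | n
  · have : ∀ᶠ i : ℤ in Filter.cofinite, y ≠ .inr (i + c) := by
      rcases y with c' | j
      · simp
      · filter_upwards [(Set.finite_singleton (j - c)).compl_mem_cofinite] with i hi h
        simp only [Sum.inr.injEq] at h
        exact hi (by simp [h])
    filter_upwards [this] with i hi
    simp [push, unpush, hi]
  · rcases τ with _ | ⟨k, τ⟩
    · simp [push, unpush]
    · filter_upwards [(Set.finite_singleton (k - c)).compl_mem_cofinite] with i hi
      have : k ≠ i + c := fun h => hi (by simp [h])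
      simp [push, unpush, this]
  · simp [push, unpush]

/-- The endomorphism of `G` moving the vertices `(0, τ)` to `(1, i :: τ)` and fixing all other
generators. -/
def retract (i : ℤ) : G →* G :=
  PresentedGroup.toGroup (f := fun o : GGen => o.elim gt' fun
      | .vert 0 τ => gvert 1 (i :: τ)
      | .vert (n + 1) τ => gvert (n + 1) τ
      | .a => ga
      | .b j => gb j) (by
    refine lift_GRels _ (fun n τ => ?_) (fun n τ j => ?_) gt_mul_gb
    · rcases n with _ | n <;> rcases τ with _ | ⟨k, τ⟩ <;>
        simp [parent, uProd_gvert_ga]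
    · rcases n with _ | n <;> simp [uProd_gvert_gb])

@[simp]
theorem retract_gvert_zero (i : ℤ) (τ : List ℤ) : retract i (gvert 0 τ) = gvert 1 (i :: τ) := by
  simp [retract, gvert]

@[simp]
theorem retract_gvert_succ (i : ℤ) (n : ℕ) (τ : List ℤ) :
    retract i (gvert (n + 1) τ) = gvert (n + 1) τ := by
  simp [retract, gvert]

@[simp]
theorem retract_ga (i : ℤ) : retract i ga = ga := by
  simp [retract, ga]

@[simp]
theorem retract_gb (i j : ℤ) : retract i (gb j) = gb j := by
  simp [retract, gb]

@[simp]
theorem retract_gt (i : ℤ) : retract i gt' = gt' := by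
  simp [retract, gt']

theorem map_push_comp_shift (i k : ℤ) :
    (Amalgam.map (push i) (step_push i)).comp (shift k) =
      (shift k).comp (Amalgam.map (push i) (step_push i)) := by
  refine Amalgam.hom_ext (fun x => ?_) fun y => ?_
  · obtain ⟨⟨_ | n, τ⟩, c⟩ := x <;> simp [push, add_assoc]
  · simp

theorem toSemidirect_retract (i : ℤ) (g : G) : toSemidirect (retract i g) =
    ⟨Amalgam.map (push i) (step_push i) (toSemidirect g).left, (toSemidirect g).right⟩ := by
  have hcomm : ∀ k, (Amalgam.map (push i) (step_push i)).comp (shiftAut k).toMonoidHom =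
      (shiftAut (MonoidHom.id _ k)).toMonoidHom.comp (Amalgam.map (push i) (step_push i)) :=
    fun k => map_push_comp_shift i k.toAdd
  have h : toSemidirect.comp (retract i) = (SemidirectProduct.map _ _ hcomm).comp toSemidirect := by
    refine G_hom_ext (fun n τ => ?_) ?_ (fun j => ?_) ?_
    · rcases n with _ | n <;> simp [push]
    all_goals simp
  exact DFunLike.congr_fun h g

theorem eventually_retract_ne_one (g : G) (hg : g ≠ 1) :
    ∀ᶠ i in Filter.cofinite, retract i g ≠ 1 := by
  have hne : toSemidirect g ≠ 1 := (map_ne_one_iff _ toSemidirect_injective).2 hg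
  by_cases hr : (toSemidirect g).right = 1
  · have hl : (toSemidirect g).left ≠ 1 := fun h => hne (SemidirectProduct.ext h hr)
    filter_upwards [Amalgam.eventually_map_ne_one step_base_injective push unpush step_push
      step_unpush eventually_unpush_push _ hl] with i hi h
    have := toSemidirect_retract i g
    rw [h, map_one] at this
    exact hi (congrArg SemidirectProduct.left this).symm
  · refine Filter.Eventually.of_forall fun i h => hr ?_
    have := toSemidirect_retract i g
    rw [h, map_one] at this
    exact (congrArg SemidirectProduct.right this).symm

theorem ga_mem : ga ∈ H := Subgroup.subset_closure (by simp)

theorem gt_mem : gt' ∈ H := Subgroup.subset_closure (by simp)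

theorem gb_mem (j : ℤ) : gb j ∈ H := by
  rw [← zero_add j, ← gt_zpow_mul_gb]
  exact mul_mem (mul_mem (zpow_mem gt_mem _) (Subgroup.subset_closure (by simp)))
    (inv_mem (zpow_mem gt_mem _))

theorem uProd_mem {M : Type*} [Group M] {S : Subgroup M} {x y : M} (hx : x ∈ S) (hy : y ∈ S) :
    uProd x y ∈ S := by
  have := map_uProd S.subtype ⟨x, hx⟩ ⟨y, hy⟩
  exact this ▸ Subtype.property _

theorem gvert_mem (n : ℕ) (τ : List ℤ) : gvert (n + 1) τ ∈ H := by
  induction τ using List.reverseRecOn with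
  | nil =>
    induction n with
    | zero => exact Subgroup.subset_closure (by simp)
    | succ n ih =>
      have := uProd_gvert_ga (n + 1) []
      exact this ▸ uProd_mem ih ga_mem
  | append_singleton τ j ih => exact uProd_gvert_gb (n + 1) τ j ▸ uProd_mem ih (gb_mem j)

theorem retract_mem (i : ℤ) (g : G) : retract i g ∈ H := by
  have hg : g ∈ Subgroup.closure (Set.range (PresentedGroup.of (rels := GRels))) := by
    rw [PresentedGroup.closure_range_of]
    trivial
  refine (Subgroup.closure_le (H.comap (retract i))).2 ?_ hg
  rintro _ ⟨_ | ⟨n, τ⟩ | _ | j, rfl⟩ <;> rw [SetLike.mem_coe, Subgroup.mem_comap]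
  · exact (retract_gt i).symm.subst (motive := (· ∈ H)) gt_mem
  · rcases n with _ | n
    · exact (retract_gvert_zero i τ).symm.subst (motive := (· ∈ H)) (gvert_mem 0 _)
    · exact (retract_gvert_succ i n τ).symm.subst (motive := (· ∈ H)) (gvert_mem n τ)
  · exact (retract_ga i).symm.subst (motive := (· ∈ H)) ga_mem
  · exact (retract_gb i j).symm.subst (motive := (· ∈ H)) (gb_mem j)

theorem retract_of_mem (i : ℤ) {g : G} (hg : g ∈ H) : retract i g = g := by
  refine MonoidHom.eqOn_closure (f := retract i) (g := MonoidHom.id G) ?_ hg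
  rintro _ (rfl | rfl | rfl | rfl) <;> simp

/-- `H` is existentially closed in `G`. -/
theorem stmt3 : ExistentiallyClosedSubgroup H := by
  rintro k m h P N ⟨g, hP, hN⟩
  have hev : ∀ᶠ i in Filter.cofinite, ∀ w ∈ N,
      retract i (FreeGroup.lift (Sum.elim (fun j => (h j : G)) g) w) ≠ 1 :=
    (Filter.eventually_all_finset N).2 fun w hw => eventually_retract_ne_one _ (hN w hw)
  obtain ⟨i, hi⟩ := hev.exists
  have hlift : ∀ w, FreeGroup.lift (Sum.elim (fun j => (h j : G)) fun j => retract i (g j)) w =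
      retract i (FreeGroup.lift (Sum.elim (fun j => (h j : G)) g) w) := by
    intro w
    rw [← MonoidHom.comp_apply]
    congr 1
    ext1 x
    rcases x with j | j
    · simp [retract_of_mem i (h j).2]
    · simp
  refine ⟨fun j => ⟨retract i (g j), retract_mem i (g j)⟩, fun w hw => ?_, fun w hw => ?_⟩
  · exact (hlift w).trans (by rw [hP w hw, map_one])
  · exact (hlift w).trans_ne (hi w hw)
end
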